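/- arXiv:2312.04039 — 3 statements merged into one kernel-verified Lean document; each statement's English description precedes it below -/
import Mathlib

section
/- Let V be a finite totally ordered set with |V| ≥ 5, and let P be a partial pairing of V. Then the tournament Inv(underline(V), P) is indecomposable if and only if ∪P is a transversal of mc(underline(V)) and P is an irreducible pairing of the totally ordered set ∪P (with the order induced from V). -/
open Set

/-- The arc relation of the tournament `Inv(underline(V), P)` obtained from the
transitive tournament on a linearly ordered type by reversing the arcs `(x,y)`
with `{x,y} ∈ P`. -/
def InvArc {α : Type*} [LinearOrder α] (P : Set (Set α)) (x y : α) : Prop :=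
  (x < y ∧ ({x, y} : Set α) ∉ P) ∨ (y < x ∧ ({x, y} : Set α) ∈ P)

/-- `M` is a module of the subtournament of `Inv(·, P)` induced on the vertex set `W`. -/
def IsModuleOn {α : Type*} [LinearOrder α] (P : Set (Set α)) (W M : Set α) : Prop :=
  M ⊆ W ∧ ∀ v ∈ W, v ∉ M →
    (∀ x ∈ M, InvArc P v x) ∨ (∀ x ∈ M, InvArc P x v)

/-- A subset of the vertex set `W` is trivial if it is empty, a singleton, or all of `W`. -/
def IsTrivialSubset {α : Type*} (W M : Set α) : Prop :=
  M = ∅ ∨ (∃ a, M = {a}) ∨ M = W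

/-- A nontrivial module of the tournament `Inv(·, P)` induced on `W`. -/
def IsNontrivialModuleOn {α : Type*} [LinearOrder α] (P : Set (Set α)) (W M : Set α) : Prop :=
  IsModuleOn P W M ∧ ¬ IsTrivialSubset W M

/-- The tournament `Inv(·, P)` induced on `W` is indecomposable: all its modules are trivial. -/
def IndecomposableOn {α : Type*} [LinearOrder α] (P : Set (Set α)) (W : Set α) : Prop :=
  ∀ M : Set α, IsModuleOn P W M → IsTrivialSubset W M

/-- The tournament `Inv(·, P)` induced on `W` is decomposable: it has a nontrivial module. -/
def DecomposableOn {α : Type*} [LinearOrder α] (P : Set (Set α)) (W : Set α) : Prop :=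
  ∃ M : Set α, IsNontrivialModuleOn P W M

/-- A co-module of the tournament `Inv(·, P)` on `W`: a subset `M` of `W` such that
`M` or `W ∖ M` is a nontrivial module. -/
def IsCoModuleOn {α : Type*} [LinearOrder α] (P : Set (Set α)) (W M : Set α) : Prop :=
  M ⊆ W ∧ (IsNontrivialModuleOn P W M ∨ IsNontrivialModuleOn P W (W \ M))

/-- `mc(underline(W))`: the family of minimal co-modules of the transitive tournament on `W`
(a minimal co-module contains no other co-module). -/
def mcOn {α : Type*} [LinearOrder α] (W : Set α) : Set (Set α) :=
  {M | IsCoModuleOn (∅ : Set (Set α)) W M ∧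
    ∀ C : Set α, IsCoModuleOn (∅ : Set (Set α)) W C → C ⊆ M → C = M}

/-- `S` is a transversal of the family `F`: it meets every member of `F`. -/
def TransversalOf {α : Type*} (S : Set α) (F : Set (Set α)) : Prop :=
  ∀ C ∈ F, (S ∩ C).Nonempty

/-- A partial pairing of `V`: a set of pairwise disjoint 2-element subsets of `V`. -/
def IsPartialPairingOn {α : Type*} (V : Set α) (P : Set (Set α)) : Prop :=
  (∀ B ∈ P, B ⊆ V ∧ B.ncard = 2) ∧
  ∀ B ∈ P, ∀ C ∈ P, B ≠ C → Disjoint B C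

/-- `I` is an interval of the totally ordered set `X`: every element of `X ∖ I` is greater
than all elements of `I` or smaller than all of them. -/
def IsIntervalOf {α : Type*} [LinearOrder α] (X I : Set α) : Prop :=
  I ⊆ X ∧ ∀ v ∈ X \ I, (∀ i ∈ I, v < i) ∨ (∀ i ∈ I, i < v)

/-- A nontrivial interval of `X`. -/
def IsNontrivialIntervalOf {α : Type*} [LinearOrder α] (X I : Set α) : Prop :=
  IsIntervalOf X I ∧ ¬ IsTrivialSubset X I

/-- A family of blocks `P` on the totally ordered set `X` is irreducible if no nontrivial
interval of `X` is a union of blocks of `P`. -/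
def IrreducibleOn {α : Type*} [LinearOrder α] (X : Set α) (P : Set (Set α)) : Prop :=
  ∀ R ⊆ P, ¬ IsNontrivialIntervalOf X (⋃₀ R)

/-- A partial quasi-pairing of `V`: a set `Q` of `m+1` two-element subsets of `V` (`m ≥ 1`)
whose union has size `2m+1`. -/
def IsPartialQuasiPairingOn {α : Type*} (V : Set α) (Q : Set (Set α)) : Prop :=
  (∀ B ∈ Q, B ⊆ V ∧ B.ncard = 2) ∧
  ∃ m : ℕ, 1 ≤ m ∧ (⋃₀ Q).ncard = 2 * m + 1 ∧ Q.ncard = m + 1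

/-- The distinguished data of a quasi-pairing `Q`: `vh = v̂_Q` is the element lying in the two
blocks `{vh, vm}` and `{vh, vp}` of `Q`, with `vm = v_Q^- < v_Q^+ = vp`. -/
def QPData {α : Type*} [LinearOrder α] (Q : Set (Set α)) (vh vm vp : α) : Prop :=
  ({vh, vm} : Set α) ∈ Q ∧ ({vh, vp} : Set α) ∈ Q ∧ vm < vp

/-- `Q_part`: the partition of `⋃₀ Q` obtained from `Q` by merging its two intersecting
blocks into `B_Q = {v̂_Q, v_Q^-, v_Q^+}`. -/
def QPart {α : Type*} [LinearOrder α] (Q : Set (Set α)) (vh vm vp : α) : Set (Set α) :=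
  (Q \ {({vh, vm} : Set α), ({vh, vp} : Set α)}) ∪ {({vh, vm, vp} : Set α)}

section Helpers

variable {α : Type*} [LinearOrder α]

lemma invArc_empty (x y : α) : InvArc (∅ : Set (Set α)) x y ↔ x < y := by
  simp [InvArc]

lemma pairing_unique {V : Set α} {P : Set (Set α)} (hP : IsPartialPairingOn V P) {x y z : α}
    (h1 : ({x, y} : Set α) ∈ P) (h2 : ({x, z} : Set α) ∈ P) : y = z := by
  by_contra hne
  have hxy : x ≠ y := by
    rintro rfl
    have := (hP.1 _ h1).2
    simp at this
  have hB : ({x, y} : Set α) ≠ {x, z} := by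
    intro h
    have : y ∈ ({x, z} : Set α) := h ▸ (by simp)
    simp only [mem_insert_iff, mem_singleton_iff] at this
    rcases this with h | h
    · exact hxy h.symm
    · exact hne h
  have hd := hP.2 _ h1 _ h2 hB
  exact Set.disjoint_left.1 hd (show x ∈ ({x, y} : Set α) by simp) (by simp)

lemma pairing_partner {V : Set α} {P : Set (Set α)} (hP : IsPartialPairingOn V P) {B : Set α}
    (hB : B ∈ P) {x : α} (hx : x ∈ B) : ∃ y, y ≠ x ∧ B = {x, y} := by
  obtain ⟨u, v, huv, rfl⟩ := Set.ncard_eq_two.1 (hP.1 B hB).2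
  simp only [mem_insert_iff, mem_singleton_iff] at hx
  rcases hx with rfl | rfl
  · exact ⟨v, huv.symm, rfl⟩
  · exact ⟨u, huv, Set.pair_comm _ _⟩

/-- Intervals are modules of the transitive tournament, and conversely. -/
lemma isModuleOn_empty {V M : Set α} :
    IsModuleOn (∅ : Set (Set α)) V M ↔ IsIntervalOf V M := by
  simp only [IsModuleOn, IsIntervalOf, invArc_empty, mem_diff, and_imp]

/-- A transversal of the minimal co-modules meets each co-module. -/
lemma meets_comodule {V : Set α} (hV : V.Finite) {X : Set α}
    (hX : TransversalOf X (mcOn V)) {C : Set α}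
    (hC : IsCoModuleOn (∅ : Set (Set α)) V C) : (X ∩ C).Nonempty := by
  have hfin : {C | IsCoModuleOn (∅ : Set (Set α)) V C}.Finite :=
    hV.finite_subsets.subset (fun C h => h.1)
  obtain ⟨D, hDC, hD⟩ := hfin.exists_le_minimal hC
  have : D ∈ mcOn V := ⟨hD.1, fun E hE hED => Set.Subset.antisymm hED (hD.2 hE hED)⟩
  exact (hX D this).mono (Set.inter_subset_inter_right _ hDC)

/-- No nontrivial interval of `V` is closed under the pairing. -/
lemma key {V : Set α} (hV : V.Finite) {P : Set (Set α)} (hP : IsPartialPairingOn V P)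
    (hT : TransversalOf (⋃₀ P) (mcOn V)) (hI : IrreducibleOn (⋃₀ P) P)
    {H : Set α} (hH : IsIntervalOf V H) (hnt : ¬ IsTrivialSubset V H)
    (hcl : ∀ x ∈ H, ∀ y, ({x, y} : Set α) ∈ P → y ∈ H) : False := by
  have hc1 : IsCoModuleOn (∅ : Set (Set α)) V H :=
    ⟨hH.1, Or.inl ⟨isModuleOn_empty.2 hH, hnt⟩⟩
  have hc2 : IsCoModuleOn (∅ : Set (Set α)) V (V \ H) := by
    refine ⟨diff_subset, Or.inr ?_⟩
    rw [Set.diff_diff_cancel_left hH.1]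
    exact ⟨isModuleOn_empty.2 hH, hnt⟩
  obtain ⟨x, hxX, hxH⟩ := meets_comodule hV hT hc1
  obtain ⟨z, hzX, hzV, hzH⟩ := meets_comodule hV hT hc2
  have hU : ⋃₀ {B | B ∈ P ∧ B ⊆ H} = ⋃₀ P ∩ H := by
    ext u
    constructor
    · rintro ⟨B, ⟨hB, hBH⟩, hu⟩
      exact ⟨⟨B, hB, hu⟩, hBH hu⟩
    · rintro ⟨⟨B, hB, hu⟩, huH⟩
      refine ⟨B, ⟨hB, ?_⟩, hu⟩
      obtain ⟨y, -, rfl⟩ := pairing_partner hP hB hu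
      have := hcl u huH y hB
      rintro w (rfl | rfl) <;> assumption
  apply hI {B | B ∈ P ∧ B ⊆ H} (fun B h => h.1)
  rw [hU]
  refine ⟨⟨inter_subset_left, ?_⟩, ?_⟩
  · rintro v ⟨hvX, hv⟩
    have hvV : v ∈ V := by
      obtain ⟨B, hB, hvB⟩ := hvX
      exact (hP.1 B hB).1 hvB
    rcases hH.2 v ⟨hvV, fun h => hv ⟨hvX, h⟩⟩ with h | h
    · exact Or.inl fun i hi => h i hi.2
    · exact Or.inr fun i hi => h i hi.2
  · rintro (h | ⟨a, h⟩ | h)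
    · have : x ∈ ⋃₀ P ∩ H := ⟨hxX, hxH⟩
      simp [h] at this
    · obtain ⟨B, hB, hxB⟩ := hxX
      obtain ⟨y, hne, rfl⟩ := pairing_partner hP hB hxB
      have h1 : x ∈ ⋃₀ P ∩ H := ⟨⟨_, hB, hxB⟩, hxH⟩
      have h2 : y ∈ ⋃₀ P ∩ H := ⟨⟨_, hB, by simp⟩, hcl x hxH y hB⟩
      rw [h] at h1 h2
      exact hne (h2.trans h1.symm)
    · have : z ∈ ⋃₀ P ∩ H := by rw [h]; exact hzX
      exact hzH this.2

lemma backward {V : Set α} (hV : V.Finite) (hcard : 5 ≤ V.ncard)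
    {P : Set (Set α)} (hP : IsPartialPairingOn V P)
    (hT : TransversalOf (⋃₀ P) (mcOn V)) (hI : IrreducibleOn (⋃₀ P) P) :
    IndecomposableOn P V := by
  intro M hM
  by_contra hnt
  have hMne : M.Nonempty := by
    rw [Set.nonempty_iff_ne_empty]
    exact fun h => hnt (Or.inl h)
  have hMfin := hV.subset hM.1
  obtain ⟨a, haM, ha⟩ := hMfin.exists_minimalFor id M hMne
  obtain ⟨b, hbM, hb⟩ := hMfin.exists_maximalFor id M hMne
  replace ha : ∀ x ∈ M, a ≤ x := fun x hx => by
    rcases le_total a x with h | h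
    · exact h
    · exact ha hx h
  replace hb : ∀ x ∈ M, x ≤ b := fun x hx => by
    rcases le_total x b with h | h
    · exact h
    · exact hb hx h
  have hab : a < b := by
    rcases (ha b hbM).lt_or_eq with h | h
    · exact h
    · exfalso
      apply hnt
      refine Or.inr (Or.inl ⟨a, ?_⟩)
      ext x
      constructor
      · intro hx
        exact le_antisymm (h ▸ hb x hx) (ha x hx)
      · rintro rfl; exact haM
  have uniq : ∀ x y z : α, ({x, y} : Set α) ∈ P → ({x, z} : Set α) ∈ P → y = z :=
    fun x y z => pairing_unique hP
  have comm : ∀ x y : α, ({x, y} : Set α) ∈ P → ({y, x} : Set α) ∈ P := by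
    intro x y h
    rwa [Set.pair_comm]
  have inV : ∀ x y : α, ({x, y} : Set α) ∈ P → y ∈ V := by
    intro x y h
    exact (hP.1 _ h).1 (by simp)
  have mod : ∀ v ∈ V, v ∉ M →
    (∀ x ∈ M, (v < x ∧ ({v, x} : Set α) ∉ P) ∨ (x < v ∧ ({v, x} : Set α) ∈ P)) ∨
    (∀ x ∈ M, (x < v ∧ ({v, x} : Set α) ∉ P) ∨ (v < x ∧ ({v, x} : Set α) ∈ P)) := by
    intro v hv hvM
    rcases hM.2 v hv hvM with h | h
    · left; exact h
    · right
      intro x hx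
      have := h x hx
      rw [InvArc, Set.pair_comm x v] at this
      exact this
  -- elements outside the hull are not partnered with `M`
  have hout : ∀ v ∈ V, v ∉ M → (v < a ∨ b < v) → ∀ x ∈ M, ({v, x} : Set α) ∉ P := by
    intro v hv hvM hvab x hx hPx
    have h1 := ha x hx
    have h2 := hb x hx
    rcases mod v hv hvM with h | h
    · have e1 := h x hx
      have e2 := h a haM
      have e3 := h b hbM
      grind
    · have e1 := h x hx
      have e2 := h a haM
      have e3 := h b hbM
      grind
  -- gap elements
  have hgap : ∀ v ∈ V, v ∉ M → a ≤ v → v ≤ b →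
      (({v, a} : Set α) ∈ P ∧ ∀ x ∈ M, x < v → x = a) ∨
      (({v, b} : Set α) ∈ P ∧ ∀ x ∈ M, v < x → x = b) := by
    intro v hv hvM hva hvb
    rcases mod v hv hvM with h | h
    · left
      have e : ({v, a} : Set α) ∈ P := by
        have := h a haM
        grind
      refine ⟨e, fun x hx hxv => ?_⟩
      have := h x hx
      grind
    · right
      have e : ({v, b} : Set α) ∈ P := by
        have := h b hbM
        grind
      refine ⟨e, fun x hx hxv => ?_⟩
      have := h x hx
      grind
  have haV := hM.1 haM
  have hbV := hM.1 hbM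
  -- the hull is all of `V`
  have hHV : {v ∈ V | a ≤ v ∧ v ≤ b} = V := by
    by_contra hne
    refine key hV hP hT hI (H := {v ∈ V | a ≤ v ∧ v ≤ b}) ⟨fun x hx => hx.1, ?_⟩ ?_ ?_
    · rintro v ⟨hv, hv'⟩
      simp only [mem_setOf_eq, not_and, not_le] at hv' ⊢
      rcases lt_or_ge v a with h | h
      · left; rintro i ⟨-, hi, -⟩; exact h.trans_le hi
      · right; rintro i ⟨-, -, hi⟩; exact hi.trans_lt (hv' hv h)
    · have m1 : a ∈ {v ∈ V | a ≤ v ∧ v ≤ b} := ⟨haV, le_rfl, hab.le⟩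
      have m2 : b ∈ {v ∈ V | a ≤ v ∧ v ≤ b} := ⟨hbV, hab.le, le_rfl⟩
      rintro (h | ⟨c, h⟩ | h)
      · rw [h] at m1; exact m1
      · rw [h] at m1 m2; exact hab.ne (m1.trans m2.symm)
      · exact hne h
    · rintro x ⟨hxV, hax, hxb⟩ y hxy
      have hyV := inV x y hxy
      refine ⟨hyV, ?_⟩
      by_cases hxM : x ∈ M
      · by_cases hyM : y ∈ M
        · exact ⟨ha y hyM, hb y hyM⟩
        · by_contra hcon
          refine hout y hyV hyM ?_ x hxM (comm _ _ hxy)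
          by_contra h
          push Not at h
          exact hcon h
      · rcases hgap x hxV hxM hax hxb with h | h
        · have := uniq _ _ _ hxy h.1
          subst this; exact ⟨le_rfl, hab.le⟩
        · have := uniq _ _ _ hxy h.1
          subst this; exact ⟨hab.le, le_rfl⟩
  have hall : ∀ v ∈ V, a ≤ v ∧ v ≤ b := fun v hv => by
    rw [← hHV] at hv; exact hv.2
  -- a pair of consecutive elements is not a block
  have hcons : ∀ x y : α, x ∈ V → ({x, y} : Set α) ∈ P →
      (∀ v ∈ V, v ≠ x → v ≠ y → (v < x ∧ v < y) ∨ (x < v ∧ y < v)) → False := by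
    intro x y hxV hxy hv
    have hyV := inV _ _ hxy
    refine key hV hP hT hI (H := {x, y}) ⟨(hP.1 _ hxy).1, ?_⟩ ?_ ?_
    · rintro v ⟨hvV, hvn⟩
      simp only [mem_insert_iff, mem_singleton_iff, not_or] at hvn
      rcases hv v hvV hvn.1 hvn.2 with h | h
      · left; rintro i (rfl | rfl); exacts [h.1, h.2]
      · right; rintro i (rfl | rfl); exacts [h.1, h.2]
    · have h2 := (hP.1 _ hxy).2
      rintro (h | ⟨c, h⟩ | h)
      · simp [h] at h2
      · simp [h] at h2
      · rw [h] at h2; omega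
    · rintro u (rfl | rfl) w hw
      · right; exact uniq _ _ _ hw hxy
      · left; exact uniq _ _ _ hw (comm _ _ hxy)
  -- two gap elements in crossing position
  have hcross : ∀ v w : α, ({v, a} : Set α) ∈ P → ({w, b} : Set α) ∈ P → w < v →
      (∀ x ∈ M, x < v → x = a) → (∀ x ∈ M, w < x → x = b) → v ∉ M → False := by
    intro v w hva hwb hwv h1 h2 hvM
    have hsub : V ⊆ ({a, w, v, b} : Set α) := by
      intro u hu
      simp only [mem_insert_iff, mem_singleton_iff]
      by_cases huM : u ∈ M
      · rcases lt_trichotomy u v with h | h | h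
        · exact Or.inl (h1 u huM h)
        · exact Or.inr (Or.inr (Or.inl h))
        · exact Or.inr (Or.inr (Or.inr (h2 u huM (hwv.trans h))))
      · rcases hgap u hu huM (hall u hu).1 (hall u hu).2 with h | h
        · exact Or.inr (Or.inr (Or.inl (uniq _ _ _ (comm _ _ h.1) (comm _ _ hva))))
        · exact Or.inr (Or.inl (uniq _ _ _ (comm _ _ h.1) (comm _ _ hwb)))
    have hle : V.ncard ≤ ({a, w, v, b} : Set α).ncard :=
      Set.ncard_le_ncard hsub (by simp)
    have i1 := Set.ncard_insert_le a ({w, v, b} : Set α)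
    have i2 := Set.ncard_insert_le w ({v, b} : Set α)
    have i3 := Set.ncard_insert_le v ({b} : Set α)
    have i4 := Set.ncard_singleton b
    omega
  have hMV : ∃ v ∈ V, v ∉ M := by
    by_contra h
    push Not at h
    exact hnt (Or.inr (Or.inr (Set.Subset.antisymm hM.1 h)))
  obtain ⟨v, hvV, hvM⟩ := hMV
  rcases hgap v hvV hvM (hall v hvV).1 (hall v hvV).2 with ⟨hva, h1⟩ | ⟨hvb, h1⟩
  · refine hcons v a hvV hva fun w hwV hwv hwa => ?_
    have hw := hall w hwV
    have haw : a < w := lt_of_le_of_ne hw.1 (Ne.symm hwa)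
    rcases lt_or_gt_of_ne hwv with hlt | hgt
    · exfalso
      have hwM : w ∉ M := fun h => hwa (h1 w h hlt)
      rcases hgap w hwV hwM hw.1 hw.2 with h | h
      · exact hwv (uniq _ _ _ (comm _ _ h.1) (comm _ _ hva))
      · exact hcross v w hva h.1 hlt h1 h.2 hvM
    · exact Or.inr ⟨hgt, haw⟩
  · refine hcons v b hvV hvb fun w hwV hwv hwb => ?_
    have hw := hall w hwV
    have hbw : w < b := lt_of_le_of_ne hw.2 hwb
    rcases lt_or_gt_of_ne hwv with hlt | hgt
    · exact Or.inl ⟨hlt, hbw⟩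
    · exfalso
      have hwM : w ∉ M := fun h => hwb (h1 w h hgt)
      rcases hgap w hwV hwM hw.1 hw.2 with h | h
      · exact hcross w v h.1 hvb hgt h.2 h1 hwM
      · exact hwv (uniq _ _ _ (comm _ _ h.1) (comm _ _ hvb))

/-- An interval of `V` with no block crossing its boundary is a module. -/
lemma interval_module {V : Set α} {P : Set (Set α)} {M : Set α} (hM : IsIntervalOf V M)
    (hcl : ∀ v ∈ V, v ∉ M → ∀ x ∈ M, ({v, x} : Set α) ∉ P) : IsModuleOn P V M := by
  refine ⟨hM.1, fun v hv hvM => ?_⟩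
  rcases hM.2 v ⟨hv, hvM⟩ with h | h
  · exact Or.inl fun x hx => Or.inl ⟨h x hx, hcl v hv hvM x hx⟩
  · refine Or.inr fun x hx => Or.inl ⟨h x hx, ?_⟩
    rw [Set.pair_comm]
    exact hcl v hv hvM x hx

lemma forward {V : Set α} {P : Set (Set α)} (hP : IsPartialPairingOn V P)
    (hInd : IndecomposableOn P V) :
    TransversalOf (⋃₀ P) (mcOn V) ∧ IrreducibleOn (⋃₀ P) P := by
  constructor
  · rintro C ⟨⟨hCV, hC⟩, -⟩
    by_contra hemp
    have hno : ∀ x ∈ C, ∀ B ∈ P, x ∉ B := fun x hx B hB hxB => hemp ⟨x, ⟨B, hB, hxB⟩, hx⟩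
    rcases hC with ⟨hm, hn⟩ | ⟨hm, hn⟩
    · refine hn (hInd _ (interval_module (isModuleOn_empty.1 hm) ?_))
      intro v _ _ x hx hB
      exact hno x hx _ hB (by simp)
    · refine hn (hInd _ (interval_module (isModuleOn_empty.1 hm) ?_))
      intro v hv hvM x hx hB
      have : v ∈ C := by
        by_contra h
        exact hvM ⟨hv, h⟩
      exact hno v this _ hB (by simp)
  · rintro R hR ⟨⟨hsub, hint⟩, hnt⟩
    have hXV : ⋃₀ P ⊆ V := by
      rintro x ⟨B, hB, hx⟩
      exact (hP.1 B hB).1 hx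
    set M : Set α := {v ∈ V | ∃ x ∈ ⋃₀ R, ∃ y ∈ ⋃₀ R, x ≤ v ∧ v ≤ y} with hMdef
    have hRM : ⋃₀ R ⊆ M := fun x hx => ⟨hXV (hsub hx), x, hx, x, hx, le_rfl, le_rfl⟩
    have hMX : ∀ v ∈ M, v ∈ ⋃₀ P → v ∈ ⋃₀ R := by
      rintro v ⟨hvV, x, hx, y, hy, hxv, hvy⟩ hvX
      by_contra hvR
      rcases hint v ⟨hvX, hvR⟩ with h | h
      · exact absurd (h x hx) (not_lt.2 hxv)
      · exact absurd (h y hy) (not_lt.2 hvy)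
    have hmod : IsModuleOn P V M := by
      apply interval_module
      · refine ⟨fun x hx => hx.1, ?_⟩
        rintro v ⟨hvV, hvM⟩
        by_contra hcon
        push Not at hcon
        obtain ⟨⟨i, ⟨-, x, hx, -, -, hxi, -⟩, hiv⟩, ⟨j, ⟨-, -, -, y, hy, -, hjy⟩, hvj⟩⟩ := hcon
        exact hvM ⟨hvV, x, hx, y, hy, hxi.trans hiv, hvj.trans hjy⟩
      · intro v hv hvM x hx hB
        obtain ⟨B, hBR, hxB⟩ := hMX x hx ⟨_, hB, by simp⟩
        obtain ⟨y, -, rfl⟩ := pairing_partner hP (hR hBR) hxB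
        rw [Set.pair_comm] at hB
        have := pairing_unique hP hB (hR hBR)
        subst this
        exact hvM (hRM ⟨_, hBR, by simp⟩)
    rcases hInd M hmod with h | ⟨a, h⟩ | h
    · exact hnt (Or.inl (Set.subset_empty_iff.1 (h ▸ hRM)))
    · rw [h] at hRM
      rcases Set.subset_singleton_iff_eq.1 hRM with h' | h'
      · exact hnt (Or.inl h')
      · exact hnt (Or.inr (Or.inl ⟨a, h'⟩))
    · refine hnt (Or.inr (Or.inr (Set.Subset.antisymm hsub fun x hx => ?_)))
      exact hMX x (h ▸ hXV hx) hx

end Helpers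

/-- Theorem 1 of the paper. For a finite totally ordered set `V` with
`|V| ≥ 5` and a partial pairing `P` of `V`, the tournament `Inv(underline(V), P)` is
indecomposable iff `⋃₀ P` is a transversal of `mc(underline(V))` and `P` is an irreducible
pairing of the totally ordered set `⋃₀ P`. -/
theorem stmt_0 {α : Type*} [LinearOrder α] (V : Set α) (hVfin : V.Finite)
    (hVcard : 5 ≤ V.ncard) (P : Set (Set α)) (hP : IsPartialPairingOn V P) :
    IndecomposableOn P V ↔
      TransversalOf (⋃₀ P) (mcOn V) ∧ IrreducibleOn (⋃₀ P) P := by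
  exact ⟨forward hP, fun h => backward hVfin hVcard hP h.1 h.2⟩
end

section
/- Let V be a finite totally ordered set with |V| ≥ 6, let Q be a partial quasi-pairing of V, and set T := Inv(underline(V), Q). Then the following are equivalent: (1) ∪Q is a transversal of mc(underline(V)) and Q is an irreducible quasi-pairing of ∪Q; (2) at least one of the tournaments T, T − v_Q^-, T − v_Q^+ is indecomposable. Moreover, when |V| = 5, assertion (2) still implies assertion (1). -/
open Set

structure QGood {α : Type*} [LinearOrder α] (W : Set α) (R : α → α → Prop) : Prop where
  sym : ∀ x y, R x y → R y x
  irr : ∀ x, ¬ R x x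
  supp : ∀ x y, R x y → x ∈ W
  bot : ∃ x, (∃ y, R x y) ∧ ∀ z ∈ W, x ≤ z
  top : ∃ x, (∃ y, R x y) ∧ ∀ z ∈ W, z ≤ x
  con : ∀ x ∈ W, ∀ y ∈ W, x < y → ∃ z, (∃ u, R z u) ∧ x ≤ z ∧ z ≤ y
  irred : ∀ I : Set α, (∀ x ∈ I, ∃ y, R x y) → (∀ x ∈ I, ∀ y, R x y → y ∈ I) →
    (∀ p ∈ I, ∀ q ∈ I, ∀ s t, R s t → p < s → s < q → s ∈ I) → I.Nonempty →
    ∀ x y, R x y → x ∈ I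

theorem QGood.dual {α : Type*} [LinearOrder α] {W : Set α} {R : α → α → Prop}
    (g : QGood W R) : @QGood αᵒᵈ _ W R where
  sym := g.sym
  irr := g.irr
  supp := g.supp
  bot := g.top
  top := g.bot
  con := fun x hx y hy hxy => by
    obtain ⟨z, h1, h2, h3⟩ := g.con y hy x hx hxy
    exact ⟨z, h1, h3, h2⟩
  irred := fun I h1 h2 h3 h4 =>
    g.irred I h1 h2 (fun p hp q hq s t hst h5 h6 => h3 q hq p hp s t hst h6 h5) h4

structure QMod {α : Type*} [LinearOrder α] (W : Set α) (R : α → α → Prop) (M : Set α)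
    (m n : α) : Prop where
  sub : ∀ y ∈ M, y ∈ W
  hm : m ∈ M
  hn : n ∈ M
  lo : ∀ y ∈ M, m ≤ y
  hi : ∀ y ∈ M, y ≤ n
  lt : m < n
  out : ∀ x ∈ W, x < m ∨ n < x → (∀ y ∈ M, R x y) ∨ (∀ y ∈ M, ¬ R x y)
  gap : ∀ x ∈ W, x ∉ M → m < x → x < n →
    (R x m ∧ (∀ y ∈ M, y < x → R x y) ∧ ∀ y ∈ M, x < y → ¬ R x y) ∨
    (R x n ∧ (∀ y ∈ M, x < y → R x y) ∧ ∀ y ∈ M, y < x → ¬ R x y)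

theorem QMod.dual {α : Type*} [LinearOrder α] {W : Set α} {R : α → α → Prop} {M : Set α}
    {m n : α} (g : QMod W R M m n) : @QMod αᵒᵈ _ W R M n m where
  sub := g.sub
  hm := g.hn
  hn := g.hm
  lo := g.hi
  hi := g.lo
  lt := g.lt
  out := fun x hx h => g.out x hx (Or.symm h)
  gap := fun x hx hM h1 h2 => Or.symm (g.gap x hx hM h2 h1)

/-- quasi-pairing relation -/
structure QRel {α : Type*} (R : α → α → Prop) (h a b : α) : Prop where
  ne : a ≠ b
  ha : R h a
  hb : R h b
  hh : ∀ y, R h y → y = a ∨ y = b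
  fn : ∀ x y z, x ≠ h → R x y → R x z → y = z

/-- between -/
def QBtw {α : Type*} [LinearOrder α] (x z y : α) : Prop := (x < z ∧ z < y) ∨ (y < z ∧ z < x)

def QOut {α : Type*} [LinearOrder α] (W : Set α) (R : α → α → Prop) (h : α) : Prop :=
  ∃ c e, R h c ∧ e ≠ c ∧ (∀ z ∈ W, ¬ QBtw c z e) ∧
    (e = h ∨ R h e ∨ (e ≠ h ∧ ∃ w, R e w ∧ QBtw e h w ∧ ∀ z ∈ W, QBtw e z w → z = h))

theorem QOut.dual {α : Type*} [LinearOrder α] {W : Set α} {R : α → α → Prop} {h : α}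
    (g : @QOut αᵒᵈ _ W R h) : QOut W R h := by
  obtain ⟨c, e, h1, h2, h3, h4⟩ := g
  have key : ∀ x z y : α, @QBtw αᵒᵈ _ x z y ↔ QBtw x z y := by
    intro x z y
    constructor
    · rintro (⟨h, h'⟩ | ⟨h, h'⟩)
      · exact Or.inr ⟨h', h⟩
      · exact Or.inl ⟨h', h⟩
    · rintro (⟨h, h'⟩ | ⟨h, h'⟩)
      · exact Or.inr ⟨h', h⟩
      · exact Or.inl ⟨h', h⟩
  refine ⟨c, e, h1, h2, fun z hz hb => h3 z hz ((key _ _ _).2 hb), ?_⟩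
  rcases h4 with h4 | h4 | ⟨h4, w, h5, h6, h7⟩
  · exact Or.inl h4
  · exact Or.inr (Or.inl h4)
  · exact Or.inr (Or.inr ⟨h4, w, h5, (key _ _ _).1 h6,
      fun z hz hb => h7 z hz ((key _ _ _).2 hb)⟩)

/-- W has at least six elements -/
def QSix {α : Type*} (W : Set α) : Prop :=
  ∀ p q r s t : α, ∃ x ∈ W, x ≠ p ∧ x ≠ q ∧ x ≠ r ∧ x ≠ s ∧ x ≠ t

theorem qL2 {α : Type*} [LinearOrder α] {W : Set α} {R : α → α → Prop} {M : Set α}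
    {m n h a b : α} (g : QGood W R) (q : QRel R h a b) (k : QMod W R M m n)
    (hW : h ∈ W) (hM : h ∉ M) (h1 : m < h) (h2 : h < n)
    (hL : ∀ y ∈ M, y < h → R h y)
    (d : α) (hd : R h d) (hdo : d < m ∨ n < d) : QOut W R h := by
  have hhm : R h m := hL m k.hm h1
  have hym : ∀ y ∈ M, y < h → y = m := by
    intro y hy hyh
    have := hL y hy hyh
    have := k.lo y hy
    have := k.hi y hy
    have := k.lt
    grind [q.hh]
  by_cases hz : ∃ z ∈ W, m < z ∧ z < h
  · obtain ⟨z, hzW, hz1, hz2⟩ := hz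
    have hzM : z ∉ M := fun hzM => by
      have := hym z hzM hz2
      exact absurd hz1 (by simp [this])
    have hmh : m ≠ h := ne_of_lt h1
    have hnh : n ≠ h := ne_of_gt h2
    have hgm : ∀ u, R u m → u = h := fun u hu => q.fn m u h hmh (g.sym _ _ hu) (g.sym _ _ hhm)
    rcases k.gap z hzW hzM hz1 (hz2.trans h2) with ⟨h3, -, -⟩ | ⟨h3, h4, -⟩
    · exact absurd (hgm z h3) (ne_of_lt hz2)
    · have hgn : ∀ u, R u n → u = z := fun u hu =>
        q.fn n u z hnh (g.sym _ _ hu) (g.sym _ _ h3)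
      have hMM : ∀ y ∈ M, y = m ∨ y = n := by
        intro y hy
        rcases lt_trichotomy y z with h5 | h5 | h5
        · exact Or.inl (hym y hy (h5.trans hz2))
        · exact absurd (h5 ▸ hy) hzM
        · exact Or.inr (q.fn z y n (ne_of_lt hz2) (h4 y hy h5) h3)
      have hH : ∀ u ∈ W, m < u → u < n → u = h ∨ u = z := by
        intro u hu hu1 hu2
        have hu3 : u ∉ M := by
          intro hu3
          rcases hMM u hu3 with h5 | h5
          · exact absurd hu1 (by simp [h5])
          · exact absurd hu2 (by simp [h5])
        rcases k.gap u hu hu3 hu1 hu2 with ⟨h5, -⟩ | ⟨h5, -⟩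
        · exact Or.inl (hgm u h5)
        · exact Or.inr (hgn u h5)
      refine ⟨m, z, hhm, ne_of_gt hz1, ?_, Or.inr (Or.inr ⟨ne_of_lt hz2, n, h3,
        Or.inl ⟨hz2, h2⟩, ?_⟩)⟩
      · rintro u hu (⟨h5, h6⟩ | ⟨h5, h6⟩)
        · rcases hH u hu h5 (h6.trans (hz2.trans h2)) with h7 | h7
          · exact absurd (h7 ▸ h6) (not_lt_of_gt hz2)
          · exact absurd (h7 ▸ h6) (lt_irrefl _)
        · exact absurd (h5.trans h6) (not_lt_of_gt hz1)
      · rintro u hu (⟨h5, h6⟩ | ⟨h5, h6⟩)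
        · rcases hH u hu (hz1.trans h5) h6 with h7 | h7
          · exact h7
          · exact absurd (h7 ▸ h5) (lt_irrefl _)
        · exact absurd (h5.trans h6) (not_lt_of_gt (hz2.trans h2))
  · refine ⟨m, h, hhm, ne_of_gt h1, ?_, Or.inl rfl⟩
    rintro u hu (⟨h5, h6⟩ | ⟨h5, h6⟩)
    · exact hz ⟨u, hu, h5, h6⟩
    · exact absurd (h5.trans h6) (not_lt_of_gt h1)

theorem qL1 {α : Type*} [LinearOrder α] {W : Set α} {R : α → α → Prop} {M : Set α}
    {m n h a b : α} (g : QGood W R) (q : QRel R h a b) (k : QMod W R M m n)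
    (six : QSix W)
    (hlo : ∀ z ∈ W, m ≤ z) (hhi : ∀ z ∈ W, z ≤ n) (hnS : ∃ u, R n u)
    (x : α) (hxW : x ∈ W) (hxM : x ∉ M)
    (hL : ∀ y ∈ M, y < x → R x y) (hL' : ∀ y ∈ M, x < y → ¬ R x y) : QOut W R h := by
  have hmM := k.hm
  have hnM := k.hn
  have hmn := k.lt
  have gap' : ∀ z ∈ W, z ∉ M →
    (R z m ∧ (∀ y ∈ M, y < z → R z y) ∧ ∀ y ∈ M, z < y → ¬ R z y) ∨
    (R z n ∧ (∀ y ∈ M, z < y → R z y) ∧ ∀ y ∈ M, y < z → ¬ R z y) := by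
    intro z hz hzM
    refine k.gap z hz hzM (lt_of_le_of_ne (hlo z hz) ?_) (lt_of_le_of_ne (hhi z hz) ?_)
    · rintro rfl; exact hzM hmM
    · rintro rfl; exact hzM hnM
  have hmx : m < x := lt_of_le_of_ne (hlo x hxW) (by rintro rfl; exact hxM hmM)
  have hxn : x < n := lt_of_le_of_ne (hhi x hxW) (by rintro rfl; exact hxM hnM)
  have hxm : R x m := hL m hmM hmx
  have sym := g.sym
  have fn := q.fn
  have hh := q.hh
  by_cases hxh : x = h
  · exfalso
    subst hxh
    obtain ⟨d, hd, hdm, hdd⟩ : ∃ d, R x d ∧ d ≠ m ∧ ∀ y, R x y → y = m ∨ y = d := by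
      have := q.ne
      rcases hh m hxm with rfl | rfl
      · exact ⟨b, q.hb, this.symm, hh⟩
      · exact ⟨a, q.ha, this, fun y hy => (hh y hy).symm⟩
    have hdx : d ≠ x := by rintro rfl; exact g.irr _ hd
    have hdW : d ∈ W := g.supp _ _ (sym _ _ hd)
    have hdM : d ∈ M := by
      by_contra hdM
      rcases gap' d hdW hdM with ⟨h1, -⟩ | ⟨h1, -⟩
      · have := fn d m x hdx h1 (sym _ _ hd)
        exact absurd this (ne_of_lt hmx)
      · have := fn d n x hdx h1 (sym _ _ hd)
        exact absurd this (ne_of_gt hxn)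
    have hdlt : d < x := by
      by_contra hc
      exact hL' d hdM (lt_of_le_of_ne (not_lt.1 hc) hdx.symm) hd
    have hmd : m ≤ d := hlo d hdW
    have hgm : ∀ u, R u m → u = x := fun u hu =>
      fn m u x (ne_of_lt hmx) (sym _ _ hu) (sym _ _ hxm)
    have hconv : ∀ z ∈ W, z < x → z = m ∨ z = d := by
      intro z hz hzx
      by_contra hc
      push Not at hc
      have hzM : z ∉ M := fun hzM => by
        rcases hdd z (hL z hzM hzx) with h1 | h1 <;> grind
      rcases gap' z hz hzM with ⟨h1, -⟩ | ⟨h1, h2, -⟩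
      · exact absurd (hgm z h1) (ne_of_lt hzx)
      · obtain ⟨t, ht, t1, t2, t3, t4, t5⟩ := six m d n x z
        have htM : t ∉ M := by
          intro htM
          rcases lt_trichotomy t x with h3 | h3 | h3
          · rcases hdd t (hL t htM h3) with h1 | h1 <;> grind
          · exact t4 h3
          · exact t3 (fn z t n (ne_of_lt hzx) (h2 t htM (hzx.trans h3)) h1)
        rcases gap' t ht htM with ⟨h3, -⟩ | ⟨h3, -⟩
        · exact t4 (hgm t h3)
        · exact t5 (fn n t z (ne_of_gt hxn) (sym _ _ h3) (sym _ _ h1))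
    have := g.irred {m, d, x} (by
        rintro y (rfl | rfl | rfl)
        · exact ⟨_, sym _ _ hxm⟩
        · exact ⟨_, sym _ _ hd⟩
        · exact ⟨_, hd⟩) (by
        rintro y (rfl | rfl | rfl) u hu
        · simp [hgm u (sym _ _ hu)]
        · simp [fn y u x hdx hu (sym _ _ hd)]
        · rcases hdd u hu with h1 | h1 <;> simp [h1]) (by
        intro p hp r hr s t hst h1 h2
        have hrx : r ≤ x := by
          rcases hr with rfl | rfl | rfl
          · exact hmx.le
          · exact hdlt.le
          · exact le_rfl
        rcases hconv s (g.supp _ _ hst) (lt_of_lt_of_le h2 hrx) with h1 | h1 <;> simp [h1])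
        ⟨m, by simp⟩
    obtain ⟨u, hu⟩ := hnS
    rcases this n u hu with h1 | h1 | h1
    · exact absurd h1 (ne_of_gt hmn)
    · exact absurd (h1 ▸ hdlt) (not_lt_of_gt hxn)
    · exact absurd h1 (ne_of_gt hxn)
  have hxy : ∀ y ∈ M, y < x → y = m := fun y hy h1 => fn x y m hxh (hL y hy h1) hxm
  by_cases hmh : m = h
  · subst hmh
    have key : ∀ z ∈ W, m < z → z < x → R m z := by
      intro z hz h1 h2
      have hzM : z ∉ M := fun hzM => absurd (hxy z hzM h2) (ne_of_gt h1)
      rcases gap' z hz hzM with ⟨h3, -⟩ | ⟨h3, h4, -⟩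
      · exact sym _ _ h3
      · exfalso
        obtain ⟨t, ht, t1, t2, t3, t4, t5⟩ := six m n a b z
        have htM : t ∉ M := by
          intro htM
          rcases lt_trichotomy t z with h5 | h5 | h5
          · exact t1 (hxy t htM (h5.trans h2))
          · exact t5 h5
          · exact t2 (fn z t n (ne_of_gt h1) (h4 t htM h5) h3)
        rcases gap' t ht htM with ⟨h5, -⟩ | ⟨h5, -⟩
        · rcases hh t (sym _ _ h5) with h6 | h6
          · exact t3 h6
          · exact t4 h6
        · exact t5 (fn n t z (ne_of_gt hmn) (sym _ _ h5) (sym _ _ h3))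
    by_cases hz : ∃ z ∈ W, m < z ∧ z < x
    · exfalso
      obtain ⟨z, hzW, hz1, hz2⟩ := hz
      have hmz := key z hzW hz1 hz2
      have hzM : z ∉ M := fun hzM => absurd (hxy z hzM hz2) (ne_of_gt hz1)
      have hdd : ∀ y, R m y → y = z ∨ y = x := by
        intro y hy
        have h1 := hh y hy
        have h2 := hh z hmz
        have h3 := hh x (sym _ _ hxm)
        grind
      have := g.irred {m, z, x} (by
        rintro y (rfl | rfl | rfl)
        · exact ⟨_, hmz⟩
        · exact ⟨_, sym _ _ hmz⟩
        · exact ⟨_, hxm⟩) (by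
        rintro y (rfl | rfl | rfl) u hu
        · rcases hdd u hu with h1 | h1 <;> simp [h1]
        · simp [fn y u m (ne_of_gt hz1) hu (sym _ _ hmz)]
        · simp [fn y u m hxh hu hxm]) (by
        intro p hp r hr s t hst h1 h2
        have hrx : r ≤ x := by
          rcases hr with rfl | rfl | rfl
          · exact hmx.le
          · exact hz2.le
          · exact le_rfl
        have hpm : m ≤ p := by
          rcases hp with rfl | rfl | rfl
          · exact le_rfl
          · exact hz1.le
          · exact hmx.le
        rcases hdd s (key s (g.supp _ _ hst) (lt_of_le_of_lt hpm h1) (lt_of_lt_of_le h2 hrx))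
          with h1 | h1 <;> simp [h1])
        ⟨m, by simp⟩
      obtain ⟨u, hu⟩ := hnS
      rcases this n u hu with h1 | h1 | h1
      · exact absurd h1 (ne_of_gt hmn)
      · exact absurd hnM (h1 ▸ hzM)
      · exact absurd h1 (ne_of_gt hxn)
    · refine ⟨x, m, sym _ _ hxm, ne_of_lt hmx, ?_, Or.inl rfl⟩
      rintro u hu (⟨h5, h6⟩ | ⟨h5, h6⟩)
      · exact absurd (h5.trans h6) (not_lt_of_gt hmx)
      · exact hz ⟨u, hu, h5, h6⟩
  · exfalso
    have hgm : ∀ u, R u m → u = x := fun u hu =>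
      fn m u x hmh (sym _ _ hu) (sym _ _ hxm)
    have key : ∀ z ∈ W, z < x → z = m := by
      intro z hz hzx
      by_contra hzm
      have hzM : z ∉ M := fun hzM => hzm (hxy z hzM hzx)
      rcases gap' z hz hzM with ⟨h3, -⟩ | ⟨h3, h4, -⟩
      · exact absurd (hgm z h3) (ne_of_lt hzx)
      by_cases hzh : z = h
      · subst hzh
        have hnz : n ≠ z := by rintro rfl; exact hzM hnM
        obtain ⟨t, ht, t1, t2, t3, t4, t5⟩ := six m a b z x
        have htM : t ∉ M := by
          intro htM
          rcases lt_trichotomy t z with h5 | h5 | h5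
          · exact t1 (hxy t htM (h5.trans hzx))
          · exact t4 h5
          · rcases hh t (h4 t htM h5) with h6 | h6
            · exact t2 h6
            · exact t3 h6
        rcases gap' t ht htM with ⟨h5, -⟩ | ⟨h5, -⟩
        · exact t5 (hgm t h5)
        · exact t4 (fn n t z hnz (sym _ _ h5) (sym _ _ h3))
      · have hMM : ∀ t ∈ M, t = m ∨ t = n := by
          intro t htM
          rcases lt_trichotomy t z with h5 | h5 | h5
          · exact Or.inl (hxy t htM (h5.trans hzx))
          · exact absurd (h5 ▸ htM) hzM
          · exact Or.inr (fn z t n hzh (h4 t htM h5) h3)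
        by_cases hnh : n = h
        · obtain ⟨t, ht, t1, t2, t3, t4, t5⟩ := six m n x a b
          have htM : t ∉ M := fun htM => by
            rcases hMM t htM with h6 | h6
            · exact t1 h6
            · exact t2 h6
          rcases gap' t ht htM with ⟨h5, -⟩ | ⟨h5, -⟩
          · exact t3 (hgm t h5)
          · subst hnh
            rcases hh t (sym _ _ h5) with h6 | h6
            · exact t4 h6
            · exact t5 h6
        · obtain ⟨t, ht, t1, t2, t3, t4, t5⟩ := six m n x z z
          have htM : t ∉ M := fun htM => by
            rcases hMM t htM with h6 | h6
            · exact t1 h6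
            · exact t2 h6
          rcases gap' t ht htM with ⟨h5, -⟩ | ⟨h5, -⟩
          · exact t3 (hgm t h5)
          · exact t4 (fn n t z hnh (sym _ _ h5) (sym _ _ h3))
    have := g.irred {m, x} (by
        rintro y (rfl | rfl)
        · exact ⟨_, sym _ _ hxm⟩
        · exact ⟨_, hxm⟩) (by
        rintro y (rfl | rfl) u hu
        · simp [hgm u (sym _ _ hu)]
        · simp [fn y u m hxh hu hxm]) (by
        intro p hp r hr s t hst h1 h2
        have hrx : r ≤ x := by
          rcases hr with rfl | rfl
          · exact hmx.le
          · exact le_rfl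
        simp [key s (g.supp _ _ hst) (lt_of_lt_of_le h2 hrx)])
        ⟨m, by simp⟩
    rcases this h a q.ha with h1 | h1
    · exact hmh h1.symm
    · exact hxh h1.symm

theorem qbounds {α : Type*} [LinearOrder α] {W : Set α} {R : α → α → Prop} {M : Set α}
    {m n : α} (g : QGood W R) (k : QMod W R M m n)
    (cl : ∀ x ∈ W, m ≤ x → x ≤ n → ∀ y, R x y → m ≤ y ∧ y ≤ n) :
    (∀ z ∈ W, m ≤ z) ∧ (∀ z ∈ W, z ≤ n) ∧ (∃ u, R m u) ∧ (∃ u, R n u) := by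
  have hI := g.irred {x | (∃ y, R x y) ∧ m ≤ x ∧ x ≤ n} (fun x hx => hx.1)
    (fun x ⟨_, h2, h3⟩ y hy => ⟨⟨x, g.sym _ _ hy⟩, cl x (g.supp _ _ hy) h2 h3 y hy⟩)
    (fun p hp r hr s t hst h1 h2 => ⟨⟨t, hst⟩, hp.2.1.trans h1.le, h2.le.trans hr.2.2⟩)
    (by
      obtain ⟨z, h1, h2, h3⟩ := g.con m (k.sub _ k.hm) n (k.sub _ k.hn) k.lt
      exact ⟨z, h1, h2, h3⟩)
  obtain ⟨x, ⟨y, hxy⟩, hx⟩ := g.bot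
  obtain ⟨x', ⟨y', hxy'⟩, hx'⟩ := g.top
  have h1 := (hI x y hxy).2.1
  have h2 := (hI x' y' hxy').2.2
  have e1 : x = m := le_antisymm (hx m (k.sub _ k.hm)) h1
  have e2 : x' = n := le_antisymm h2 (hx' n (k.sub _ k.hn))
  subst e1 e2
  exact ⟨hx, hx', ⟨y, hxy⟩, ⟨y', hxy'⟩⟩

theorem qmain {α : Type*} [LinearOrder α] {W : Set α} {R : α → α → Prop} {M : Set α}
    {m n h a b : α} (g : QGood W R) (q : QRel R h a b) (k : QMod W R M m n)
    (six : QSix W) (r : α) (hr : r ∈ W) (hrM : r ∉ M) : QOut W R h := by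
  have hmM := k.hm
  have hnM := k.hn
  have hmn := k.lt
  have hlo := k.lo
  have hhi := k.hi
  have sym := g.sym
  have fn := q.fn
  have hh := q.hh
  have gap := k.gap
  by_cases hA : ∃ x ∈ W, (x < m ∨ n < x) ∧ R x m ∧ R x n
  · obtain ⟨x, hxW, hx1, hx2, hx3⟩ := hA
    have hxh : x = h := by
      by_contra hc
      exact absurd (fn x m n hc hx2 hx3) (ne_of_lt hmn)
    subst hxh
    have hmx : m ≠ x := by rintro rfl; exact g.irr _ hx2
    have hnx : n ≠ x := by rintro rfl; exact g.irr _ hx3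
    refine ⟨m, n, hx2, ne_of_gt hmn, ?_, Or.inr (Or.inl hx3)⟩
    rintro u hu (⟨h5, h6⟩ | ⟨h5, h6⟩)
    · have huM : u ∉ M := by
        intro huM
        rcases k.out x hxW hx1 with h7 | h7
        · have := hh u (h7 u huM)
          have := hh m hx2
          have := hh n hx3
          grind
        · exact h7 m hmM hx2
      rcases gap u hu huM h5 h6 with ⟨h7, -⟩ | ⟨h7, -⟩
      · have := fn m u x hmx (sym _ _ h7) (sym _ _ hx2)
        grind
      · have := fn n u x hnx (sym _ _ h7) (sym _ _ hx3)
        grind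
    · exact absurd (h5.trans h6) (not_lt_of_gt hmn)
  have hN : ∀ x ∈ W, x < m ∨ n < x → ∀ y ∈ M, ¬ R x y := by
    intro x hx h1
    rcases k.out x hx h1 with h2 | h2
    · exact absurd ⟨x, hx, h1, h2 m hmM, h2 n hnM⟩ hA
    · exact h2
  have hhW : h ∈ W := g.supp _ _ q.ha
  by_cases hB : h ∉ M ∧ m < h ∧ h < n ∧ ∃ d, R h d ∧ (d < m ∨ n < d)
  · obtain ⟨h1, h2, h3, d, h4, h5⟩ := hB
    rcases gap h hhW h1 h2 h3 with ⟨h6, h7, h8⟩ | ⟨h6, h7, h8⟩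
    · exact qL2 g q k hhW h1 h2 h3 h7 d h4 h5
    · exact QOut.dual (qL2 g.dual q k.dual hhW h1 h3 h2 h7 d h4 h5.symm)
  have cl : ∀ x ∈ W, m ≤ x → x ≤ n → ∀ y, R x y → m ≤ y ∧ y ≤ n := by
    intro x hx h1 h2 y hy
    by_contra hc
    have hc' : y < m ∨ n < y := by
      by_contra hc2
      push Not at hc2
      exact hc hc2
    have hyW : y ∈ W := g.supp _ _ (sym _ _ hy)
    have hxM : x ∉ M := fun hxM => hN y hyW hc' x hxM (sym _ _ hy)
    have h1' : m < x := lt_of_le_of_ne h1 (by rintro rfl; exact hxM hmM)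
    have h2' : x < n := lt_of_le_of_ne h2 (by rintro rfl; exact hxM hnM)
    have hxh : x ≠ h := by
      rintro rfl
      exact hB ⟨hxM, h1', h2', y, hy, hc'⟩
    rcases gap x hx hxM h1' h2' with ⟨h3, -⟩ | ⟨h3, -⟩
    · have := fn x y m hxh hy h3
      subst this
      exact hc ⟨le_rfl, hmn.le⟩
    · have := fn x y n hxh hy h3
      subst this
      exact hc ⟨hmn.le, le_rfl⟩
  obtain ⟨b1, b2, b3, b4⟩ := qbounds g k cl
  have h1 : m < r := lt_of_le_of_ne (b1 r hr) (by rintro rfl; exact hrM hmM)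
  have h2 : r < n := lt_of_le_of_ne (b2 r hr) (by rintro rfl; exact hrM hnM)
  rcases gap r hr hrM h1 h2 with ⟨h6, h7, h8⟩ | ⟨h6, h7, h8⟩
  · exact qL1 g q k six b1 b2 b4 r hr hrM h7 h8
  · exact QOut.dual (qL1 g.dual q k.dual six b2 b1 b3 r hr hrM h7 h8)

/-- W has at least five elements -/
def QFive {α : Type*} (W : Set α) : Prop :=
  ∀ p q r s : α, ∃ x ∈ W, x ≠ p ∧ x ≠ q ∧ x ≠ r ∧ x ≠ s

theorem qP1 {α : Type*} [LinearOrder α] {W : Set α} {R : α → α → Prop} {M : Set α}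
    {m n : α} (g : QGood W R) (fn : ∀ x y z, R x y → R x z → y = z) (k : QMod W R M m n)
    (five : QFive W)
    (hlo : ∀ z ∈ W, m ≤ z) (hhi : ∀ z ∈ W, z ≤ n) (hnS : ∃ u, R n u)
    (x : α) (hxW : x ∈ W) (hxM : x ∉ M)
    (hL : ∀ y ∈ M, y < x → R x y) : False := by
  have hmM := k.hm
  have hnM := k.hn
  have hmn := k.lt
  have gap' : ∀ z ∈ W, z ∉ M →
    (R z m ∧ (∀ y ∈ M, y < z → R z y) ∧ ∀ y ∈ M, z < y → ¬ R z y) ∨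
    (R z n ∧ (∀ y ∈ M, z < y → R z y) ∧ ∀ y ∈ M, y < z → ¬ R z y) := by
    intro z hz hzM
    refine k.gap z hz hzM (lt_of_le_of_ne (hlo z hz) ?_) (lt_of_le_of_ne (hhi z hz) ?_)
    · rintro rfl; exact hzM hmM
    · rintro rfl; exact hzM hnM
  have hmx : m < x := lt_of_le_of_ne (hlo x hxW) (by rintro rfl; exact hxM hmM)
  have hxn : x < n := lt_of_le_of_ne (hhi x hxW) (by rintro rfl; exact hxM hnM)
  have hxm : R x m := hL m hmM hmx
  have sym := g.sym
  have hxy : ∀ y ∈ M, y < x → y = m := fun y hy h1 => fn x y m (hL y hy h1) hxm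
  have hgm : ∀ u, R u m → u = x := fun u hu =>
      fn m u x (sym _ _ hu) (sym _ _ hxm)
  have key : ∀ z ∈ W, z < x → z = m := by
    intro z hz hzx
    by_contra hzm
    have hzM : z ∉ M := fun hzM => hzm (hxy z hzM hzx)
    rcases gap' z hz hzM with ⟨h3, -⟩ | ⟨h3, h4, -⟩
    · exact absurd (hgm z h3) (ne_of_lt hzx)
    obtain ⟨t, ht, t1, t2, t3, t4⟩ := five m n x z
    have htM : t ∉ M := by
      intro htM
      rcases lt_trichotomy t z with h5 | h5 | h5
      · exact t1 (hxy t htM (h5.trans hzx))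
      · exact t4 h5
      · exact t2 (fn z t n (h4 t htM h5) h3)
    rcases gap' t ht htM with ⟨h5, -⟩ | ⟨h5, -⟩
    · exact t3 (hgm t h5)
    · exact t4 (fn n t z (sym _ _ h5) (sym _ _ h3))
  have := g.irred {m, x} (by
      rintro y (rfl | rfl)
      · exact ⟨_, sym _ _ hxm⟩
      · exact ⟨_, hxm⟩) (by
      rintro y (rfl | rfl) u hu
      · simp [hgm u (sym _ _ hu)]
      · simp [fn y u m hu hxm]) (by
      intro p hp r hr s t hst h1 h2
      have hrx : r ≤ x := by
        rcases hr with rfl | rfl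
        · exact hmx.le
        · exact le_rfl
      simp [key s (g.supp _ _ hst) (lt_of_lt_of_le h2 hrx)])
      ⟨m, by simp⟩
  obtain ⟨u, hu⟩ := hnS
  rcases this n u hu with h1 | h1
  · exact absurd h1 (ne_of_gt hmn)
  · exact absurd h1 (ne_of_gt hxn)

theorem qpair {α : Type*} [LinearOrder α] {W : Set α} {R : α → α → Prop} {M : Set α}
    {m n : α} (g : QGood W R) (fn : ∀ x y z, R x y → R x z → y = z) (k : QMod W R M m n)
    (five : QFive W) (r : α) (hr : r ∈ W) (hrM : r ∉ M) : False := by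
  have hmM := k.hm
  have hnM := k.hn
  have hmn := k.lt
  have sym := g.sym
  have gap := k.gap
  have hN : ∀ x ∈ W, x < m ∨ n < x → ∀ y ∈ M, ¬ R x y := by
    intro x hx h1
    rcases k.out x hx h1 with h2 | h2
    · exact absurd (fn x m n (h2 m hmM) (h2 n hnM)) (ne_of_lt hmn)
    · exact h2
  have cl : ∀ x ∈ W, m ≤ x → x ≤ n → ∀ y, R x y → m ≤ y ∧ y ≤ n := by
    intro x hx h1 h2 y hy
    by_contra hc
    have hc' : y < m ∨ n < y := by
      by_contra hc2
      push Not at hc2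
      exact hc hc2
    have hyW : y ∈ W := g.supp _ _ (sym _ _ hy)
    have hxM : x ∉ M := fun hxM => hN y hyW hc' x hxM (sym _ _ hy)
    have h1' : m < x := lt_of_le_of_ne h1 (by rintro rfl; exact hxM hmM)
    have h2' : x < n := lt_of_le_of_ne h2 (by rintro rfl; exact hxM hnM)
    rcases gap x hx hxM h1' h2' with ⟨h3, -⟩ | ⟨h3, -⟩
    · have := fn x y m hy h3
      subst this
      exact hc ⟨le_rfl, hmn.le⟩
    · have := fn x y n hy h3
      subst this
      exact hc ⟨hmn.le, le_rfl⟩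
  obtain ⟨b1, b2, b3, b4⟩ := qbounds g k cl
  have h1 : m < r := lt_of_le_of_ne (b1 r hr) (by rintro rfl; exact hrM hmM)
  have h2 : r < n := lt_of_le_of_ne (b2 r hr) (by rintro rfl; exact hrM hnM)
  rcases gap r hr hrM h1 h2 with ⟨h6, h7, h8⟩ | ⟨h6, h7, h8⟩
  · exact qP1 g fn k five b1 b2 b4 r hr hrM h7
  · exact qP1 g.dual fn k.dual five b2 b1 b3 r hr hrM h7

/-- delete a vertex -/
def QDel {α : Type*} (R : α → α → Prop) (c : α) (x y : α) : Prop := R x y ∧ x ≠ c ∧ y ≠ c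

theorem qred {α : Type*} [LinearOrder α] {W : Set α} {R : α → α → Prop}
    {h a b : α} (g : QGood W R) (q : QRel R h a b) (o : QOut W R h) :
    ∃ c, R h c ∧ QGood (W \ {c}) (QDel R c) := by
  obtain ⟨c, e, hc, hec, hadj, hcase⟩ := o
  have sym := g.sym
  have fn := q.fn
  have hh := q.hh
  refine ⟨c, hc, ?_⟩
  obtain ⟨d, hd, hdc, hdd⟩ : ∃ d, R h d ∧ d ≠ c ∧ ∀ y, R h y → y = c ∨ y = d := by
    have := q.ne
    rcases hh c hc with rfl | rfl
    · exact ⟨b, q.hb, this.symm, hh⟩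
    · exact ⟨a, q.ha, this, fun y hy => (hh y hy).symm⟩
  have hhc : h ≠ c := by rintro rfl; exact g.irr _ hc
  have hgc : ∀ u, R u c → u = h := fun u hu => fn c u h hhc.symm (sym _ _ hu) (sym _ _ hc)
  have hhd : QDel R c h d := ⟨hd, hhc, hdc⟩
  have hS : ∀ z, (∃ u, R z u) → z ≠ c → ∃ u, QDel R c z u := by
    rintro z ⟨u, hu⟩ hz
    by_cases huc : u = c
    · subst huc
      obtain rfl := hgc z hu
      exact ⟨d, hhd⟩
    · exact ⟨u, hu, hz, huc⟩
  have heS : ∃ u, R e u := by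
    rcases hcase with h1 | h1 | ⟨_, w, h1, _⟩
    · exact ⟨c, h1 ▸ hc⟩
    · exact ⟨h, sym _ _ h1⟩
    · exact ⟨w, h1⟩
  have heW : e ∈ W := by
    obtain ⟨u, hu⟩ := heS
    exact g.supp _ _ hu
  have hcW : c ∈ W := g.supp _ _ (sym _ _ hc)
  have heS' := hS e heS hec
  have hadj1 : ∀ z ∈ W, z < c → z = e ∨ z < e := by
    intro z hz h1
    by_contra hcon
    push Not at hcon
    exact hadj z hz (Or.inr ⟨lt_of_le_of_ne hcon.2 (Ne.symm hcon.1), h1⟩)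
  have hadj2 : ∀ z ∈ W, c < z → z = e ∨ e < z := by
    intro z hz h1
    by_contra hcon
    push Not at hcon
    exact hadj z hz (Or.inl ⟨h1, lt_of_le_of_ne hcon.2 hcon.1⟩)
  refine ⟨?_, ?_, ?_, ?_, ?_, ?_, ?_⟩
  · rintro x y ⟨h1, h2, h3⟩
    exact ⟨sym _ _ h1, h3, h2⟩
  · rintro x ⟨h1, -⟩
    exact g.irr _ h1
  · rintro x y ⟨h1, h2, h3⟩
    exact ⟨g.supp _ _ h1, h2⟩
  · obtain ⟨x, hx, hx2⟩ := g.bot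
    by_cases hxc : x = c
    · subst hxc
      refine ⟨e, heS', fun z hz => ?_⟩
      rcases hadj2 z hz.1 (lt_of_le_of_ne (hx2 z hz.1) (Ne.symm hz.2)) with h1 | h1
      · exact h1.ge
      · exact h1.le
    · exact ⟨x, hS x hx hxc, fun z hz => hx2 z hz.1⟩
  · obtain ⟨x, hx, hx2⟩ := g.top
    by_cases hxc : x = c
    · subst hxc
      refine ⟨e, heS', fun z hz => ?_⟩
      rcases hadj1 z hz.1 (lt_of_le_of_ne (hx2 z hz.1) (hz.2)) with h1 | h1
      · exact h1.le
      · exact h1.le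
    · exact ⟨x, hS x hx hxc, fun z hz => hx2 z hz.1⟩
  · intro x hx y hy hxy
    obtain ⟨z, h1, h2, h3⟩ := g.con x hx.1 y hy.1 hxy
    by_cases hzc : z = c
    · subst hzc
      refine ⟨e, heS', ?_, ?_⟩
      · rcases hadj1 x hx.1 (lt_of_le_of_ne h2 hx.2) with h4 | h4
        · exact h4.le
        · exact h4.le
      · rcases hadj2 y hy.1 (lt_of_le_of_ne h3 (Ne.symm hy.2)) with h4 | h4
        · exact h4.ge
        · exact h4.le
    · exact ⟨z, hS z h1 hzc, h2, h3⟩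
  · intro I hI1 hI2 hI3 hI4
    have hIc : c ∉ I := fun hcI => by
      obtain ⟨y, -, h2, -⟩ := hI1 c hcI
      exact h2 rfl
    have hIW : ∀ x ∈ I, x ∈ W := fun x hx => by
      obtain ⟨y, h1, -⟩ := hI1 x hx
      exact g.supp _ _ h1
    have heh : e ∈ I ↔ h ∈ I := by
      rcases hcase with h1 | h1 | ⟨h1, w, h2, h3, h4⟩
      · rw [h1]
      · have : QDel R c h e := ⟨h1, hhc, hec⟩
        exact ⟨fun h5 => hI2 e h5 h ⟨sym _ _ h1, hec, hhc⟩, fun h5 => hI2 h h5 e this⟩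
      · have hwc : w ≠ c := by rintro rfl; exact h1 (hgc _ h2)
        have hew : QDel R c e w := ⟨h2, hec, hwc⟩
        have hwe : QDel R c w e := ⟨sym _ _ h2, hwc, hec⟩
        have hwh : w ≠ h := by
          rintro rfl
          rcases h3 with ⟨h5, h6⟩ | ⟨h5, h6⟩
          · exact lt_irrefl _ h6
          · exact lt_irrefl _ h5
        constructor
        · intro h5
          have h6 := hI2 e h5 w hew
          rcases h3 with ⟨h7, h8⟩ | ⟨h7, h8⟩
          · exact hI3 e h5 w h6 h d hhd h7 h8
          · exact hI3 w h6 e h5 h d hhd h7 h8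
        · intro h5
          have h6 := hI2 h h5 d hhd
          have hdh : d ≠ h := by rintro rfl; exact g.irr _ hd
          have hde : d ≠ e := by
            rintro rfl
            exact hwh (fn d w h h1 h2 (sym _ _ hd))
          have hdw : d ≠ w := by
            rintro rfl
            exact h1 (fn d e h hwh (sym _ _ h2) (sym _ _ hd))
          have hdb : ¬ QBtw e d w := fun h7 => hdh (h4 d (hIW d h6) h7)
          by_contra heI
          have hwI : w ∉ I := fun hwI => heI (hI2 w hwI e hwe)
          unfold QBtw at hdb h3
          have := hI3 h h5 d h6 e w hew
          have := hI3 h h5 d h6 w e hwe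
          have := hI3 d h6 h h5 e w hew
          have := hI3 d h6 h h5 w e hwe
          grind
    intro x y hxy
    by_cases hhI : h ∈ I
    · have heI := heh.2 hhI
      have := g.irred (insert c I) (by
          rintro x (rfl | hx)
          · exact ⟨h, sym _ _ hc⟩
          · obtain ⟨y, h1, -⟩ := hI1 x hx
            exact ⟨y, h1⟩) (by
          rintro x (rfl | hx) y hxy
          · exact Or.inr (hgc y (sym _ _ hxy) ▸ hhI)
          · by_cases hy : y = c
            · exact Or.inl hy
            · exact Or.inr (hI2 x hx y ⟨hxy, fun h1 => hIc (h1 ▸ hx), hy⟩)) (by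
          intro p hp r hr s t hst h1 h2
          by_cases hsc : s = c
          · exact Or.inl hsc
          right
          have hsW := g.supp _ _ hst
          obtain ⟨t', ht'⟩ := hS s ⟨t, hst⟩ hsc
          rcases hp with rfl | hp
          · rcases hr with rfl | hr
            · exact absurd (h1.trans h2) (lt_irrefl _)
            · rcases hadj2 s hsW h1 with h3 | h3
              · exact h3 ▸ heI
              · exact hI3 e heI r hr s t' ht' h3 h2
          · rcases hr with rfl | hr
            · rcases hadj1 s hsW h2 with h3 | h3
              · exact h3 ▸ heI
              · exact hI3 p hp e heI s t' ht' h1 h3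
            · exact hI3 p hp r hr s t' ht' h1 h2) ⟨c, Or.inl rfl⟩ x y hxy.1
      exact this.resolve_left hxy.2.1
    · have heI : e ∉ I := fun h1 => hhI (heh.1 h1)
      refine g.irred I ?_ ?_ ?_ hI4 x y hxy.1
      · intro x hx
        obtain ⟨y, h1, -⟩ := hI1 x hx
        exact ⟨y, h1⟩
      · intro x hx y hxy'
        by_cases hy : y = c
        · rw [hy] at hxy'
          exact absurd (hgc x hxy' ▸ hx) hhI
        · exact hI2 x hx y ⟨hxy', fun h1 => hIc (h1 ▸ hx), hy⟩
      · intro p hp r hr s t hst h1 h2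
        by_cases hsc : s = c
        · subst hsc
          exfalso
          obtain ⟨u, hu⟩ := heS'
          rcases hadj1 p (hIW p hp) h1 with h3 | h3
          · exact heI (h3 ▸ hp)
          rcases hadj2 r (hIW r hr) h2 with h4 | h4
          · exact heI (h4 ▸ hr)
          exact heI (hI3 p hp r hr e u hu h3 h4)
        · obtain ⟨t', ht'⟩ := hS s ⟨t, hst⟩ hsc
          exact hI3 p hp r hr s t' ht' h1 h2

theorem qcount {α : Type*} {Q : Set (Set α)} {h a b : α} (k : ℕ)
    (h2 : ∀ B ∈ Q, B.ncard = 2) (hS : (⋃₀ Q).ncard = 2 * k + 1) (hQ : Q.ncard = k + 1)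
    (ha : ({h, a} : Set α) ∈ Q) (hb : ({h, b} : Set α) ∈ Q) (hab : a ≠ b) :
    QRel (fun x y => ({x, y} : Set α) ∈ Q) h a b := by
  classical
  have hirr : ∀ x y : α, ({x, y} : Set α) ∈ Q → x ≠ y := by
    rintro x y hxy rfl
    have := h2 _ hxy
    simp at this
  have hQf : Q.Finite := Set.finite_of_ncard_ne_zero (by omega)
  have hSf : (⋃₀ Q).Finite := Set.finite_of_ncard_ne_zero (by omega)
  set F := hQf.toFinset with hF
  set S := hSf.toFinset with hSS
  have hFc : F.card = k + 1 := by rw [← hQ, Set.ncard_eq_toFinset_card Q hQf]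
  have hSc : S.card = 2 * k + 1 := by rw [← hS, Set.ncard_eq_toFinset_card _ hSf]
  have hdc := Finset.sum_card_bipartiteAbove_eq_sum_card_bipartiteBelow
    (s := S) (t := F) (fun (x : α) (B : Set α) => x ∈ B)
  have hr : ∑ B ∈ F, (Finset.bipartiteBelow (fun (x : α) (B : Set α) => x ∈ B) S B).card
      = 2 * (k + 1) := by
    rw [Finset.sum_const_nat (m := 2), hFc, mul_comm]
    intro B hB
    have hB' : B ∈ Q := by simpa [hF] using hB
    rw [← h2 B hB', ← Set.ncard_coe_finset]
    congr 1
    ext x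
    simp only [Finset.bipartiteBelow, Finset.coe_filter, Set.mem_setOf_eq, hSS,
      Set.Finite.mem_toFinset]
    exact ⟨fun h => h.2, fun h => ⟨⟨B, hB', h⟩, h⟩⟩
  set deg : α → ℕ := fun x =>
    (Finset.bipartiteAbove (fun (x : α) (B : Set α) => x ∈ B) F x).card with hdeg
  have hdegS : ∑ x ∈ S, deg x = 2 * (k + 1) := by rw [← hr, ← hdc]
  have hdegle : ∀ (x : α) (G : Finset (Set α)), (∀ B ∈ G, B ∈ Q ∧ x ∈ B) → G.card ≤ deg x := by
    intro x G hG
    apply Finset.card_le_card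
    intro B hB
    simp only [Finset.bipartiteAbove, Finset.mem_filter]
    exact ⟨by simpa [hF] using (hG B hB).1, (hG B hB).2⟩
  have hpos : ∀ x ∈ S, 1 ≤ deg x := by
    intro x hx
    have : x ∈ ⋃₀ Q := by simpa [hSS] using hx
    obtain ⟨B, hB, hxB⟩ := this
    have := hdegle x {B} (by simpa using ⟨hB, hxB⟩)
    simpa using this
  have hsum : ∑ x ∈ S, (deg x - 1) = 1 := by
    have : ∑ x ∈ S, deg x = ∑ x ∈ S, (deg x - 1) + ∑ x ∈ S, 1 := by
      rw [← Finset.sum_add_distrib]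
      apply Finset.sum_congr rfl
      intro x hx
      have := hpos x hx
      omega
    rw [hdegS] at this
    simp [hSc] at this
    omega
  have hpne : ∀ x y z : α, ({x, y} : Set α) ∈ Q → ({x, z} : Set α) ∈ Q → y ≠ z →
      ({x, y} : Set α) ≠ {x, z} := by
    intro x y z h1 h3 h4 h5
    have : y ∈ ({x, z} : Set α) := h5 ▸ (by simp)
    rcases this with h6 | h6
    · exact hirr _ _ h1 h6.symm
    · exact h4 h6
  have hmemS : ∀ x y : α, ({x, y} : Set α) ∈ Q → x ∈ S := by
    intro x y hxy
    simp only [hSS, Set.Finite.mem_toFinset]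
    exact ⟨_, hxy, by simp⟩
  have hdh : 2 ≤ deg h := by
    have := hdegle h {{h, a}, {h, b}} (by simp [ha, hb])
    rwa [Finset.card_pair (hpne _ _ _ ha hb hab)] at this
  refine ⟨hab, ha, hb, ?_, ?_⟩
  · intro y hy
    by_contra hc
    push Not at hc
    have := hdegle h {{h, y}, {h, a}, {h, b}} (by simp [ha, hb]; exact hy)
    rw [Finset.card_insert_of_notMem, Finset.card_pair (hpne _ _ _ ha hb hab)] at this
    · have h5 := Finset.single_le_sum (f := fun x => deg x - 1) (s := S)
        (fun _ _ => Nat.zero_le _) (hmemS _ _ ha)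
      simp only [hsum] at h5
      omega
    · simp only [Finset.mem_insert, Finset.mem_singleton, not_or]
      exact ⟨hpne _ _ _ hy ha hc.1, hpne _ _ _ hy hb hc.2⟩
  · intro x y z hxh hy hz
    by_contra hc
    have h6 := hdegle x {{x, y}, {x, z}} (by simp; exact ⟨hy, hz⟩)
    rw [Finset.card_pair (hpne _ _ _ hy hz hc)] at h6
    have h5 := Finset.sum_le_sum_of_subset (f := fun x => deg x - 1)
      (show ({x, h} : Finset α) ⊆ S by
        intro u hu
        simp only [Finset.mem_insert, Finset.mem_singleton] at hu
        rcases hu with rfl | rfl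
        · exact hmemS _ _ hy
        · exact hmemS _ _ ha)
    rw [Finset.sum_pair hxh] at h5
    simp only [hsum] at h5
    omega

theorem qclosed {α : Type*} [LinearOrder α] {Q : Set (Set α)} {h a b : α}
    (h2 : ∀ B ∈ Q, B.ncard = 2)
    (q : QRel (fun x y => ({x, y} : Set α) ∈ Q) h a b)
    (F : Set (Set α)) (hF : F ⊆ QPart Q h a b) :
    ∀ x ∈ ⋃₀ F, ∀ y, ({x, y} : Set α) ∈ Q → y ∈ ⋃₀ F := by
  rintro x ⟨B, hB, hxB⟩ y hxy
  have hirr : ∀ x y : α, ({x, y} : Set α) ∈ Q → x ≠ y := by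
    rintro x y hxy rfl
    have := h2 _ hxy
    simp at this
  refine ⟨B, hB, ?_⟩
  have sa : ({a, h} : Set α) ∈ Q := by rw [Set.pair_comm]; exact q.ha
  have sb : ({b, h} : Set α) ∈ Q := by rw [Set.pair_comm]; exact q.hb
  rcases hF hB with ⟨h1, h3⟩ | h1
  · obtain ⟨u, w, huw, rfl⟩ := Set.ncard_eq_two.1 (h2 B h1)
    have key : ∀ u w : α, ({u, w} : Set α) ∈ Q →
        ({u, w} : Set α) ∉ ({({h, a} : Set α), ({h, b} : Set α)} : Set (Set α)) → u ≠ h := by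
      rintro u w h4 h5 rfl
      rcases q.hh w h4 with rfl | rfl
      · exact h5 (by simp)
      · exact h5 (by simp)
    have h1' : ({w, u} : Set α) ∈ Q := by rw [Set.pair_comm]; exact h1
    rcases hxB with rfl | rfl
    · have := q.fn x y w (key x w h1 h3) hxy h1
      simp [this]
    · have := q.fn x y u (key x u h1' (by rw [Set.pair_comm x u]; exact h3)) hxy h1'
      simp [this]
  · obtain rfl : B = {h, a, b} := h1
    rcases hxB with rfl | rfl | rfl
    · rcases q.hh y hxy with rfl | rfl <;> simp
    · simp [q.fn x y h (hirr _ _ sa) hxy sa]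
    · simp [q.fn x y h (hirr _ _ sb) hxy sb]

theorem qback {α : Type*} [LinearOrder α] {V W : Set α} {Q : Set (Set α)} {h a b : α}
    (h2 : ∀ B ∈ Q, B ⊆ V ∧ B.ncard = 2)
    (q : QRel (fun x y => ({x, y} : Set α) ∈ Q) h a b)
    (hWV : W ⊆ V) (hh : h ∈ W) (hW : ∀ x ∈ V, x ≠ a → x ≠ b → x ∈ W) (hab : a ∈ W ∨ b ∈ W)
    (hind : IndecomposableOn Q W) :
    TransversalOf (⋃₀ Q) (mcOn V) ∧ IrreducibleOn (⋃₀ Q) (QPart Q h a b) := by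
  have hirr : ∀ x y : α, ({x, y} : Set α) ∈ Q → x ≠ y := by
    rintro x y hxy rfl
    have := (h2 _ hxy).2
    simp at this
  have hS1 : ∀ x y : α, ({x, y} : Set α) ∈ Q → x ∈ ⋃₀ Q := fun x y h => ⟨_, h, by simp⟩
  have hS2 : ∀ x y : α, ({x, y} : Set α) ∈ Q → y ∈ ⋃₀ Q := fun x y h => ⟨_, h, by simp⟩
  have hSh := hS1 _ _ q.ha
  have hSa := hS2 _ _ q.ha
  have hSb := hS2 _ _ q.hb
  have hne_a := hirr _ _ q.ha
  have hne_b := hirr _ _ q.hb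
  constructor
  · intro C hC
    by_contra hcon
    have hCS : ∀ x ∈ C, x ∉ ⋃₀ Q := fun x hx hxS => hcon ⟨x, hxS, hx⟩
    have hCV : C ⊆ V := hC.1.1
    have hCW : C ⊆ W := fun x hx => hW x (hCV hx)
      (by rintro rfl; exact hCS _ hx hSa) (by rintro rfl; exact hCS _ hx hSb)
    rcases hC.1.2 with ⟨hM, ht⟩ | ⟨hM, ht⟩
    · have := hind C ⟨hCW, fun v hv hvC => by
        rcases hM.2 v (hWV hv) hvC with h1 | h1
        · left
          intro x hx
          rcases h1 x hx with h3 | h3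
          · exact Or.inl ⟨h3.1, fun h4 => hCS x hx (hS2 _ _ h4)⟩
          · exact absurd h3.2 (by simp)
        · right
          intro x hx
          rcases h1 x hx with h3 | h3
          · exact Or.inl ⟨h3.1, fun h4 => hCS x hx (hS1 _ _ h4)⟩
          · exact absurd h3.2 (by simp)⟩
      rcases this with h1 | h1 | h1
      · exact ht (Or.inl h1)
      · exact ht (Or.inr (Or.inl h1))
      · exact hCS h (h1 ▸ hh) hSh
    · have := hind (W \ C) ⟨fun x hx => hx.1, fun v hv hvC => by
        have hvC' : v ∈ C := by
          by_contra h5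
          exact hvC ⟨hv, h5⟩
        rcases hM.2 v (hWV hv) (fun h5 => h5.2 hvC') with h1 | h1
        · left
          intro x hx
          rcases h1 x ⟨hWV hx.1, hx.2⟩ with h3 | h3
          · exact Or.inl ⟨h3.1, fun h4 => hCS v hvC' (hS1 _ _ h4)⟩
          · exact absurd h3.2 (by simp)
        · right
          intro x hx
          rcases h1 x ⟨hWV hx.1, hx.2⟩ with h3 | h3
          · exact Or.inl ⟨h3.1, fun h4 => hCS v hvC' (hS2 _ _ h4)⟩
          · exact absurd h3.2 (by simp)⟩
      have hh' : h ∈ W \ C := ⟨hh, fun h5 => hCS h h5 hSh⟩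
      rcases this with h1 | ⟨s, h1⟩ | h1
      · rw [h1] at hh'; exact hh'
      · have e1 : h = s := by rw [h1] at hh'; exact hh'
        rcases hab with h6 | h6
        · have : a ∈ W \ C := ⟨h6, fun h5 => hCS a h5 hSa⟩
          rw [h1] at this
          exact hne_a (e1.trans this.symm)
        · have : b ∈ W \ C := ⟨h6, fun h5 => hCS b h5 hSb⟩
          rw [h1] at this
          exact hne_b (e1.trans this.symm)
      · apply ht
        right; right
        ext x
        constructor
        · exact fun hx => hx.1
        · intro hx
          refine ⟨hx, fun hxC => ?_⟩
          have : x ∈ W \ C := by rw [h1]; exact hCW hxC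
          exact this.2 hxC
  · rintro F hF ⟨⟨hIS, hI⟩, hnt⟩
    have hcl := qclosed (fun B hB => (h2 B hB).2) q F hF
    set I := ⋃₀ F
    have hconv : ∀ p ∈ I, ∀ r ∈ I, ∀ x ∈ ⋃₀ Q, p ≤ x → x ≤ r → x ∈ I := by
      intro p hp r hr x hx h3 h4
      by_contra h5
      rcases hI x ⟨hx, h5⟩ with h6 | h6
      · exact absurd (h6 p hp) (not_lt_of_ge h3)
      · exact absurd (h6 r hr) (not_lt_of_ge h4)
    have hah : h ∈ I → a ∈ I ∧ b ∈ I := fun h3 => ⟨hcl h h3 a q.ha, hcl h h3 b q.hb⟩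
    have hha : a ∈ I → h ∈ I := fun h3 => hcl a h3 h (by rw [Set.pair_comm]; exact q.ha)
    have hhb : b ∈ I → h ∈ I := fun h3 => hcl b h3 h (by rw [Set.pair_comm]; exact q.hb)
    have hSV : ∀ x ∈ ⋃₀ Q, x ∈ V := by
      rintro x ⟨B, hB, hx⟩
      exact (h2 B hB).1 hx
    obtain ⟨x, hx⟩ : I.Nonempty := by
      by_contra h3
      exact hnt (Or.inl (Set.not_nonempty_iff_eq_empty.1 h3))
    obtain ⟨y, hxy⟩ : ∃ y, ({x, y} : Set α) ∈ Q := by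
      obtain ⟨B, hB, hxB⟩ := hIS hx
      obtain ⟨u, w, huw, rfl⟩ := Set.ncard_eq_two.1 (h2 B hB).2
      rcases hxB with rfl | rfl
      · exact ⟨w, hB⟩
      · exact ⟨u, by rw [Set.pair_comm]; exact hB⟩
    have hy := hcl x hx y hxy
    have two : ∃ u w, u ≠ w ∧ (u ∈ I ∧ u ∈ W) ∧ (w ∈ I ∧ w ∈ W) := by
      by_cases h3 : h ∈ I
      · rcases hab with h6 | h6
        · exact ⟨h, a, hne_a, ⟨h3, hh⟩, (hah h3).1, h6⟩
        · exact ⟨h, b, hne_b, ⟨h3, hh⟩, (hah h3).2, h6⟩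
      · refine ⟨x, y, hirr _ _ hxy, ⟨hx, hW x (hSV _ (hIS hx)) ?_ ?_⟩,
          ⟨hy, hW y (hSV _ (hIS hy)) ?_ ?_⟩⟩
        · rintro rfl; exact h3 (hha hx)
        · rintro rfl; exact h3 (hhb hx)
        · rintro rfl; exact h3 (hha hy)
        · rintro rfl; exact h3 (hhb hy)
    have := hind {v | v ∈ W ∧ ∃ p ∈ I, ∃ r ∈ I, p ≤ v ∧ v ≤ r} ⟨fun v hv => hv.1, by
      intro v hv hvJ
      have hno : ∀ z, z ∈ {v | v ∈ W ∧ ∃ p ∈ I, ∃ r ∈ I, p ≤ v ∧ v ≤ r} →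
          ({v, z} : Set α) ∉ Q := by
        rintro z ⟨hz, p, hp, r, hr, h3, h4⟩ h5
        have h6 := hconv p hp r hr z (hS2 _ _ h5) h3 h4
        have h7 := hcl z h6 v (by rw [Set.pair_comm]; exact h5)
        exact hvJ ⟨hv, v, h7, v, h7, le_rfl, le_rfl⟩
      by_cases h3 : ∃ p ∈ I, p ≤ v
      · obtain ⟨p, hp, h3⟩ := h3
        right
        rintro z hz
        refine Or.inl ⟨?_, fun h5 => hno z hz (by rw [Set.pair_comm]; exact h5)⟩
        obtain ⟨hz, p', hp', r, hr, h4, h5⟩ := hz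
        by_contra h6
        exact hvJ ⟨hv, p, hp, r, hr, h3, (not_lt.1 h6).trans h5⟩
      · left
        rintro z hz
        refine Or.inl ⟨?_, hno z hz⟩
        obtain ⟨hz, p', hp', r, hr, h4, h5⟩ := hz
        by_contra h6
        exact h3 ⟨p', hp', h4.trans (not_lt.1 h6)⟩⟩
    obtain ⟨u, w, huw, hu, hw⟩ := two
    have hu' : u ∈ {v | v ∈ W ∧ ∃ p ∈ I, ∃ r ∈ I, p ≤ v ∧ v ≤ r} :=
      ⟨hu.2, u, hu.1, u, hu.1, le_rfl, le_rfl⟩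
    have hw' : w ∈ {v | v ∈ W ∧ ∃ p ∈ I, ∃ r ∈ I, p ≤ v ∧ v ≤ r} :=
      ⟨hw.2, w, hw.1, w, hw.1, le_rfl, le_rfl⟩
    rcases this with h3 | ⟨s, h3⟩ | h3
    · rw [h3] at hu'; exact hu'
    · rw [h3] at hu' hw'
      exact huw (hu'.trans hw'.symm)
    · have hall : ∀ z ∈ W, z ∈ ⋃₀ Q → z ∈ I := by
        intro z hz hzS
        have : z ∈ {v | v ∈ W ∧ ∃ p ∈ I, ∃ r ∈ I, p ≤ v ∧ v ≤ r} := by rw [h3]; exact hz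
        obtain ⟨_, p, hp, r, hr, h4, h5⟩ := this
        exact hconv p hp r hr z hzS h4 h5
      have hhI := hall h hh hSh
      apply hnt
      right; right
      apply Set.Subset.antisymm hIS
      intro z hz
      by_cases h4 : z = a
      · exact h4 ▸ (hah hhI).1
      by_cases h5 : z = b
      · exact h5 ▸ (hah hhI).2
      exact hall z (hW z (hSV z hz) h4 h5) hz

theorem qmod_of {α : Type*} [LinearOrder α] {W : Set α} {Q : Set (Set α)}
    {R : α → α → Prop} (hR : ∀ x ∈ W, ∀ y ∈ W, R x y ↔ ({x, y} : Set α) ∈ Q)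
    (hfin : W.Finite) (hnd : ¬ IndecomposableOn Q W) :
    ∃ M m n, QMod W R M m n ∧ ∃ r ∈ W, r ∉ M := by
  unfold IndecomposableOn at hnd
  push Not at hnd
  obtain ⟨M, ⟨hMW, hM⟩, ht⟩ := hnd
  have hMf := hfin.subset hMW
  have hMn : M.Nonempty := by
    by_contra h3
    exact ht (Or.inl (Set.not_nonempty_iff_eq_empty.1 h3))
  obtain ⟨m, hm, hlo⟩ := Set.exists_min_image M id hMf hMn
  obtain ⟨n, hn, hhi⟩ := Set.exists_max_image M id hMf hMn
  simp only [id] at hlo hhi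
  have hr : ∃ r ∈ W, r ∉ M := by
    by_contra hc
    push Not at hc
    exact ht (Or.inr (Or.inr (Set.Subset.antisymm hMW hc)))
  have hmn : m < n := by
    refine lt_of_le_of_ne (hlo n hn) ?_
    rintro rfl
    refine ht (Or.inr (Or.inl ⟨m, ?_⟩))
    ext y
    constructor
    · intro hy
      exact le_antisymm (hhi y hy) (hlo y hy)
    · rintro rfl
      exact hm
  have arc1 : ∀ x ∈ W, ∀ y ∈ W, x < y → (InvArc Q x y ↔ ¬ R x y) := by
    intro x hx y hy hxy
    rw [hR x hx y hy]
    unfold InvArc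
    have := not_lt_of_gt hxy
    tauto
  have arc2 : ∀ x ∈ W, ∀ y ∈ W, y < x → (InvArc Q x y ↔ R x y) := by
    intro x hx y hy hxy
    rw [hR x hx y hy]
    unfold InvArc
    have := not_lt_of_gt hxy
    tauto
  have hsym : ∀ x ∈ W, ∀ y ∈ W, (R x y ↔ R y x) := by
    intro x hx y hy
    rw [hR x hx y hy, hR y hy x hx, Set.pair_comm]
  have b1 : ∀ x ∈ W, ∀ y ∈ M, x < y → (InvArc Q x y ↔ ¬ R x y) := fun x hx y hy h1 =>
    arc1 x hx y (hMW hy) h1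
  have b2 : ∀ x ∈ W, ∀ y ∈ M, x < y → (InvArc Q y x ↔ R x y) := fun x hx y hy h1 => by
    rw [arc2 y (hMW hy) x hx h1, hsym y (hMW hy) x hx]
  have b3 : ∀ x ∈ W, ∀ y ∈ M, y < x → (InvArc Q x y ↔ R x y) := fun x hx y hy h1 =>
    arc2 x hx y (hMW hy) h1
  have b4 : ∀ x ∈ W, ∀ y ∈ M, y < x → (InvArc Q y x ↔ ¬ R x y) := fun x hx y hy h1 => by
    rw [arc1 y (hMW hy) x hx h1, hsym y (hMW hy) x hx]
  refine ⟨M, m, n, ⟨hMW, hm, hn, hlo, hhi, hmn, ?_, ?_⟩, hr⟩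
  · rintro x hx (h1 | h1)
    · have hxM : x ∉ M := fun h => absurd (hlo x h) (not_le_of_gt h1)
      rcases hM x hx hxM with h3 | h3
      · exact Or.inr fun y hy => (b1 x hx y hy (lt_of_lt_of_le h1 (hlo y hy))).1 (h3 y hy)
      · exact Or.inl fun y hy => (b2 x hx y hy (lt_of_lt_of_le h1 (hlo y hy))).1 (h3 y hy)
    · have hxM : x ∉ M := fun h => absurd (hhi x h) (not_le_of_gt h1)
      rcases hM x hx hxM with h3 | h3
      · exact Or.inl fun y hy => (b3 x hx y hy (lt_of_le_of_lt (hhi y hy) h1)).1 (h3 y hy)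
      · exact Or.inr fun y hy => (b4 x hx y hy (lt_of_le_of_lt (hhi y hy) h1)).1 (h3 y hy)
  · intro x hx hxM h1 h2
    rcases hM x hx hxM with h3 | h3
    · left
      exact ⟨(b3 x hx m hm h1).1 (h3 m hm), fun y hy h4 => (b3 x hx y hy h4).1 (h3 y hy),
        fun y hy h4 => (b1 x hx y hy h4).1 (h3 y hy)⟩
    · right
      exact ⟨(b2 x hx n hn h2).1 (h3 n hn), fun y hy h4 => (b2 x hx y hy h4).1 (h3 y hy),
        fun y hy h4 => (b4 x hx y hy h4).1 (h3 y hy)⟩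

theorem qtrans {α : Type*} [LinearOrder α] {V S : Set α} (hV : V.Finite)
    (ht : TransversalOf S (mcOn V)) (C : Set α)
    (hC : IsCoModuleOn (∅ : Set (Set α)) V C) : (S ∩ C).Nonempty := by
  have hf : {D : Set α | IsCoModuleOn (∅ : Set (Set α)) V D ∧ D ⊆ C}.Finite :=
    hV.finite_subsets.subset fun D hD => hD.1.1
  obtain ⟨D, hD⟩ := hf.exists_minimal ⟨C, hC, Set.Subset.rfl⟩
  have hDm : D ∈ mcOn V := by
    refine ⟨hD.1.1, fun E hE hED => ?_⟩
    exact Set.Subset.antisymm hED (hD.2 ⟨hE, hED.trans hD.1.2⟩ hED)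
  obtain ⟨x, hx1, hx2⟩ := ht D hDm
  exact ⟨x, hx1, hD.1.2 hx2⟩

theorem qgood_of {α : Type*} [LinearOrder α] {V : Set α} {Q : Set (Set α)} {h a b : α}
    (hV : V.Finite) (six : QSix V)
    (h2 : ∀ B ∈ Q, B ⊆ V ∧ B.ncard = 2)
    (q : QRel (fun x y => ({x, y} : Set α) ∈ Q) h a b)
    (ht : TransversalOf (⋃₀ Q) (mcOn V)) (hi : IrreducibleOn (⋃₀ Q) (QPart Q h a b)) :
    QGood V (fun x y => ({x, y} : Set α) ∈ Q) := by
  have hirr : ∀ x : α, ({x, x} : Set α) ∉ Q := by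
    rintro x hxy
    have := (h2 _ hxy).2
    simp at this
  have hS : ∀ x ∈ ⋃₀ Q, ∃ y, ({x, y} : Set α) ∈ Q := by
    rintro x ⟨B, hB, hxB⟩
    obtain ⟨u, w, huw, rfl⟩ := Set.ncard_eq_two.1 (h2 B hB).2
    rcases hxB with rfl | rfl
    · exact ⟨w, hB⟩
    · exact ⟨u, by rw [Set.pair_comm]; exact hB⟩
  have hS1 : ∀ x y : α, ({x, y} : Set α) ∈ Q → x ∈ ⋃₀ Q := fun x y h => ⟨_, h, by simp⟩
  have hS2 : ∀ x y : α, ({x, y} : Set α) ∈ Q → y ∈ ⋃₀ Q := fun x y h => ⟨_, h, by simp⟩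
  have arc : ∀ x y : α, InvArc (∅ : Set (Set α)) x y ↔ x < y := by
    intro x y
    simp [InvArc]
  have hVn : V.Nonempty := by
    obtain ⟨x, hx, -⟩ := six h h h h h
    exact ⟨x, hx⟩
  -- a subset missing at most one vertex is not small
  have hbig : ∀ v : α, v ∈ V → ¬ IsTrivialSubset V (V \ {v}) := by
    rintro v hv (h1 | ⟨s, h1⟩ | h1)
    · obtain ⟨x, hx, h3, -⟩ := six v v v v v
      have : x ∈ V \ {v} := ⟨hx, h3⟩
      rw [h1] at this
      exact this
    · obtain ⟨x, hx, h3, h4, -⟩ := six v s v v v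
      have : x ∈ V \ {v} := ⟨hx, h3⟩
      rw [h1] at this
      exact h4 this
    · have : v ∈ V \ {v} := by rw [h1]; exact hv
      exact this.2 rfl
  have hbot : ∃ x, (∃ y, ({x, y} : Set α) ∈ Q) ∧ ∀ z ∈ V, x ≤ z := by
    obtain ⟨m, hm, hlo⟩ := Set.exists_min_image V id hV hVn
    obtain ⟨x, hx1, hx2⟩ := qtrans hV ht {m} ⟨by simpa using hm, Or.inr ⟨⟨fun x hx => hx.1, by
      intro v hv hvm
      have hvm : v = m := by
        by_contra h5
        exact hvm ⟨hv, h5⟩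
      subst hvm
      left
      intro x hx
      rw [arc]
      exact lt_of_le_of_ne (hlo x hx.1) (Ne.symm hx.2)⟩, hbig m hm⟩⟩
    obtain rfl : x = m := hx2
    exact ⟨x, hS x hx1, hlo⟩
  have htop : ∃ x, (∃ y, ({x, y} : Set α) ∈ Q) ∧ ∀ z ∈ V, z ≤ x := by
    obtain ⟨m, hm, hlo⟩ := Set.exists_max_image V id hV hVn
    obtain ⟨x, hx1, hx2⟩ := qtrans hV ht {m} ⟨by simpa using hm, Or.inr ⟨⟨fun x hx => hx.1, by
      intro v hv hvm
      have hvm : v = m := by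
        by_contra h5
        exact hvm ⟨hv, h5⟩
      subst hvm
      right
      intro x hx
      rw [arc]
      exact lt_of_le_of_ne (hlo x hx.1) (hx.2)⟩, hbig m hm⟩⟩
    obtain rfl : x = m := hx2
    exact ⟨x, hS x hx1, hlo⟩
  refine ⟨fun x y h => by rw [Set.pair_comm]; exact h, hirr,
    fun x y h => (h2 _ h).1 (by simp), hbot, htop, ?_, ?_⟩
  · intro x hx y hy hxy
    by_cases hall : ∀ z ∈ V, x ≤ z ∧ z ≤ y
    · obtain ⟨z, ⟨u, hu⟩, hz⟩ := hbot
      exact ⟨z, ⟨u, hu⟩, hall z ((h2 _ hu).1 (by simp))⟩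
    · push Not at hall
      obtain ⟨t, htV, htx⟩ := hall
      obtain ⟨z, hz1, hz2⟩ := qtrans hV ht {z | z ∈ V ∧ x ≤ z ∧ z ≤ y} ⟨fun z hz => hz.1,
        Or.inl ⟨⟨fun z hz => hz.1, by
          intro v hv hvm
          by_cases h3 : x ≤ v
          · right
            intro z hz
            rw [arc]
            by_contra h4
            exact hvm ⟨hv, h3, (not_lt.1 h4).trans hz.2.2⟩
          · left
            intro z hz
            rw [arc]
            exact lt_of_lt_of_le (not_le.1 h3) hz.2.1⟩, by
          have hx' : x ∈ {z | z ∈ V ∧ x ≤ z ∧ z ≤ y} := ⟨hx, le_rfl, hxy.le⟩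
          have hy' : y ∈ {z | z ∈ V ∧ x ≤ z ∧ z ≤ y} := ⟨hy, hxy.le, le_rfl⟩
          rintro (h1 | ⟨s, h1⟩ | h1)
          · rw [h1] at hx'; exact hx'
          · rw [h1] at hx' hy'
            exact absurd (hx'.trans hy'.symm) (ne_of_lt hxy)
          · have : t ∈ {z | z ∈ V ∧ x ≤ z ∧ z ≤ y} := by rw [h1]; exact htV
            exact absurd this.2.2 (not_le_of_gt (htx this.2.1))⟩⟩
      exact ⟨z, hS z hz1, hz2.2⟩
  · intro I hI1 hI2 hI3 hI4
    have hIS : I ⊆ ⋃₀ Q := fun x hx => by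
      obtain ⟨y, hy⟩ := hI1 x hx
      exact hS1 _ _ hy
    have hU : ⋃₀ {B | B ∈ QPart Q h a b ∧ B ⊆ I} = I := by
      apply Set.Subset.antisymm
      · rintro x ⟨B, hB, hx⟩
        exact hB.2 hx
      · intro x hx
        obtain ⟨y, hy⟩ := hI1 x hx
        have hyI := hI2 x hx y hy
        by_cases h3 : ({x, y} : Set α) ∈ ({({h, a} : Set α), ({h, b} : Set α)} : Set (Set α))
        · have hxyI : ({x, y} : Set α) ⊆ I := by
            rintro z (rfl | rfl)
            · exact hx
            · exact hyI
          have hxm : x ∈ ({x, y} : Set α) := by simp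
          have hhI : h ∈ I := by
            rcases h3 with h3 | h3
            · exact hxyI (by rw [h3]; simp)
            · exact hxyI (by rw [h3]; simp)
          refine ⟨{h, a, b}, ⟨Or.inr rfl, ?_⟩, ?_⟩
          · rintro z (rfl | rfl | rfl)
            · exact hhI
            · exact hI2 h hhI _ q.ha
            · exact hI2 h hhI _ q.hb
          · rcases h3 with h3 | h3
            · rw [h3] at hxm
              rcases hxm with h4 | h4
              · simp [h4]
              · rw [Set.mem_singleton_iff] at h4
                simp [h4]
            · rw [h3] at hxm
              rcases hxm with h4 | h4
              · simp [h4]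
              · rw [Set.mem_singleton_iff] at h4
                simp [h4]
        · refine ⟨{x, y}, ⟨Or.inl ⟨hy, h3⟩, ?_⟩, by simp⟩
          rintro z (rfl | rfl)
          · exact hx
          · exact hyI
    have h3 := hi {B | B ∈ QPart Q h a b ∧ B ⊆ I} (fun B hB => hB.1)
    rw [hU] at h3
    have h4 : IsTrivialSubset (⋃₀ Q) I := by
      by_contra h5
      refine h3 ⟨⟨hIS, ?_⟩, h5⟩
      rintro v ⟨hv1, hv2⟩
      obtain ⟨w, hw⟩ := hS v hv1
      by_cases h6 : ∃ p ∈ I, p < v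
      · obtain ⟨p, hp, h6⟩ := h6
        right
        intro i hiI
        by_contra h7
        have h8 : v < i := lt_of_le_of_ne (not_lt.1 h7) (by rintro rfl; exact hv2 hiI)
        exact hv2 (hI3 p hp i hiI v w hw h6 h8)
      · left
        intro i hiI
        by_contra h7
        exact h6 ⟨i, hiI, lt_of_le_of_ne (not_lt.1 h7) (by rintro rfl; exact hv2 hiI)⟩
    intro x y hxy
    rcases h4 with h4 | ⟨s, h4⟩ | h4
    · rw [h4] at hI4
      exact absurd hI4 (by simp)
    · have hsI : s ∈ I := by rw [h4]; rfl
      obtain ⟨t, hst⟩ := hI1 s hsI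
      have htI := hI2 s hsI t hst
      rw [h4] at htI
      obtain rfl : t = s := htI
      exact absurd hst (hirr t)
    · rw [h4]
      exact hS1 _ _ hxy

theorem qsix_of {α : Type*} {V : Set α} (hc : 6 ≤ V.ncard) : QSix V := by
  intro p q r s t
  by_contra hcon
  push Not at hcon
  have hsub : V ⊆ {p, q, r, s, t} := by
    intro x hx
    by_cases h1 : x = p
    · simp [h1]
    by_cases h2 : x = q
    · simp [h2]
    by_cases h3 : x = r
    · simp [h3]
    by_cases h4 : x = s
    · simp [h4]
    simp [hcon x hx h1 h2 h3 h4]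
  have h1 := Set.ncard_le_ncard hsub (by simp)
  have h2 := Set.ncard_insert_le p {q, r, s, t}
  have h3 := Set.ncard_insert_le q {r, s, t}
  have h4 := Set.ncard_insert_le r {s, t}
  have h5 := Set.ncard_insert_le s {t}
  have h6 := Set.ncard_singleton t
  omega

/-- Theorem 2. Let `V` be a finite totally ordered set, `Q` a partial
quasi-pairing of `V` with distinguished data `(v̂_Q, v_Q^-, v_Q^+) = (vh, vm, vp)`, and
`T := Inv(underline(V), Q)`. If `|V| ≥ 6`, then `⋃₀ Q` is a transversal of
`mc(underline(V))` and `Q` is an irreducible quasi-pairing of `⋃₀ Q` iff at least one of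
`T`, `T − v_Q^-`, `T − v_Q^+` is indecomposable; moreover, when `|V| = 5` the second
assertion still implies the first. -/
theorem stmt_2 {α : Type*} [LinearOrder α] (V : Set α) (hVfin : V.Finite)
    (Q : Set (Set α)) (hQ : IsPartialQuasiPairingOn V Q)
    (vh vm vp : α) (hdata : QPData Q vh vm vp) :
    (6 ≤ V.ncard →
      ((TransversalOf (⋃₀ Q) (mcOn V) ∧ IrreducibleOn (⋃₀ Q) (QPart Q vh vm vp)) ↔
        (IndecomposableOn Q V ∨ IndecomposableOn Q (V \ {vm}) ∨
          IndecomposableOn Q (V \ {vp})))) ∧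
    (V.ncard = 5 →
      (IndecomposableOn Q V ∨ IndecomposableOn Q (V \ {vm}) ∨
          IndecomposableOn Q (V \ {vp})) →
        (TransversalOf (⋃₀ Q) (mcOn V) ∧ IrreducibleOn (⋃₀ Q) (QPart Q vh vm vp))) := by
  obtain ⟨h2, k, -, hk1, hk2⟩ := hQ
  obtain ⟨d1, d2, d3⟩ := hdata
  have q := qcount k (fun B hB => (h2 B hB).2) hk1 hk2 d1 d2 (ne_of_lt d3)
  have hirr : ∀ x y : α, ({x, y} : Set α) ∈ Q → x ≠ y := by
    rintro x y hxy rfl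
    have := (h2 _ hxy).2
    simp at this
  have hne_a := hirr _ _ d1
  have hne_b := hirr _ _ d2
  have hhV : vh ∈ V := (h2 _ d1).1 (by simp)
  have haV : vm ∈ V := (h2 _ d1).1 (by simp)
  have hbV : vp ∈ V := (h2 _ d2).1 (by simp)
  have back : (IndecomposableOn Q V ∨ IndecomposableOn Q (V \ {vm}) ∨
          IndecomposableOn Q (V \ {vp})) →
        (TransversalOf (⋃₀ Q) (mcOn V) ∧ IrreducibleOn (⋃₀ Q) (QPart Q vh vm vp)) := by
    rintro (hi | hi | hi)
    · exact qback h2 q Set.Subset.rfl hhV (fun x hx _ _ => hx) (Or.inl haV) hi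
    · exact qback h2 q Set.diff_subset ⟨hhV, hne_a⟩ (fun x hx h3 _ => ⟨hx, h3⟩)
        (Or.inr ⟨hbV, ne_of_gt d3⟩) hi
    · exact qback h2 q Set.diff_subset ⟨hhV, hne_b⟩ (fun x hx _ h3 => ⟨hx, h3⟩)
        (Or.inl ⟨haV, ne_of_lt d3⟩) hi
  refine ⟨fun h6 => ⟨?_, back⟩, fun _ => back⟩
  rintro ⟨ht, hi⟩
  have six := qsix_of h6
  have g := qgood_of hVfin six h2 q ht hi
  by_cases hind : IndecomposableOn Q V
  · exact Or.inl hind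
  right
  obtain ⟨M, m, n, hM, r, hr, hrM⟩ :=
    qmod_of (R := fun x y => ({x, y} : Set α) ∈ Q) (fun x _ y _ => Iff.rfl) hVfin hind
  obtain ⟨c, hc, gc⟩ := qred g q (qmain g q hM six r hr hrM)
  have hcind : IndecomposableOn Q (V \ {c}) := by
    by_contra hcon
    obtain ⟨M, m, n, hM, r, hr, hrM⟩ :=
      qmod_of (R := QDel (fun x y => ({x, y} : Set α) ∈ Q) c) (W := V \ {c})
        (fun x hx y hy => ⟨fun h => h.1, fun h => ⟨h, hx.2, hy.2⟩⟩)
        (hVfin.subset Set.diff_subset) hcon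
    refine qpair gc ?_ hM ?_ r hr hrM
    · rintro x y z ⟨e1, e2, e3⟩ ⟨e4, e5, e6⟩
      by_cases hx : x = vh
      · subst hx
        have f1 := q.hh y e1
        have f2 := q.hh z e4
        have f3 := q.hh c hc
        rcases f3 with rfl | rfl
        · exact (f1.resolve_left e3).trans (f2.resolve_left e6).symm
        · exact (f1.resolve_right e3).trans (f2.resolve_right e6).symm
      · exact q.fn x y z hx e1 e4
    · intro p1 p2 p3 p4
      obtain ⟨x, hx, x1, x2, x3, x4, x5⟩ := six p1 p2 p3 p4 c
      exact ⟨x, ⟨hx, x5⟩, x1, x2, x3, x4⟩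
  rcases q.hh c hc with rfl | rfl
  · exact Or.inl hcind
  · exact Or.inr hcind
end

section
/- Let V be a finite totally ordered set of odd size with |V| ≥ 7, let Q be a quasi-pairing of V (so ∪Q = V), and set T := Inv(underline(V), Q). Then Q is irreducible if and only if at least one of the tournaments T, T − v_Q^-, T − v_Q^+ is indecomposable. -/
open Set

/-- Intervals, in a convenient form. -/
def Itv {α : Type*} [LinearOrder α] (X I : Set α) : Prop :=
  I ⊆ X ∧ ∀ v ∈ X, v ∉ I → (∀ i ∈ I, v < i) ∨ (∀ i ∈ I, i < v)

/-- Modules of the tournament obtained by reversing the edges of `A`, in a self-dual form. -/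
def Md {α : Type*} [LinearOrder α] (A : α → α → Prop) (W M : Set α) : Prop :=
  M ⊆ W ∧ ∀ v ∈ W, v ∉ M →
    (∀ x ∈ M, (v < x ↔ ¬ A v x)) ∨ (∀ x ∈ M, (x < v ↔ ¬ A v x))

/-- Closed under `A` inside `W`. -/
def Cl {α : Type*} (A : α → α → Prop) (W I : Set α) : Prop :=
  ∀ x ∈ I, ∀ y ∈ W, A x y → y ∈ I

/-- No nontrivial closed interval. -/
def Irr {α : Type*} [LinearOrder α] (A : α → α → Prop) (W : Set α) : Prop :=
  ∀ I, Itv W I → Cl A W I → IsTrivialSubset W I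

/-- The convex hull of `M` in `W`. -/
def Hull {α : Type*} [LinearOrder α] (W M : Set α) : Set α :=
  {w | w ∈ W ∧ (∃ x ∈ M, x ≤ w) ∧ (∃ y ∈ M, w ≤ y)}

theorem itv_dual {α : Type*} [LinearOrder α] {X I : Set α} :
    @Itv αᵒᵈ _ X I ↔ Itv X I := by
  unfold Itv
  constructor
  · rintro ⟨h, h'⟩
    exact ⟨h, fun v hv hvi => (h' v hv hvi).symm⟩
  · rintro ⟨h, h'⟩
    exact ⟨h, fun v hv hvi => (h' v hv hvi).symm⟩

theorem md_dual {α : Type*} [LinearOrder α] {A : α → α → Prop} {X I : Set α} :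
    @Md αᵒᵈ _ A X I ↔ Md A X I := by
  unfold Md
  constructor
  · rintro ⟨h, h'⟩
    exact ⟨h, fun v hv hvi => (h' v hv hvi).symm⟩
  · rintro ⟨h, h'⟩
    exact ⟨h, fun v hv hvi => (h' v hv hvi).symm⟩

theorem irr_dual {α : Type*} [LinearOrder α] {A : α → α → Prop} {X : Set α} :
    @Irr αᵒᵈ _ A X ↔ Irr A X := by
  unfold Irr
  constructor
  · intro h I hI
    exact h I (itv_dual.2 hI)
  · intro h I hI
    exact h I (itv_dual.1 hI)

theorem hull_itv {α : Type*} [LinearOrder α] (W M : Set α) : Itv W (Hull W M) := by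
  refine ⟨fun w hw => hw.1, fun v hv hvi => ?_⟩
  by_cases h : ∃ x ∈ M, x ≤ v
  · right
    rintro i ⟨_, _, y, hy, hiy⟩
    by_contra hc
    exact hvi ⟨hv, h, y, hy, (not_lt.1 hc).trans hiy⟩
  · left
    rintro i ⟨_, ⟨x, hx, hxi⟩, _⟩
    push Not at h
    exact (h x hx).trans_le hxi

theorem sub_hull {α : Type*} [LinearOrder α] {W M : Set α} (h : M ⊆ W) : M ⊆ Hull W M :=
  fun x hx => ⟨h hx, ⟨x, hx, le_rfl⟩, ⟨x, hx, le_rfl⟩⟩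

/-- A vertex outside `M` in the hull has a neighbour in `M`. -/
theorem hull_nbr {α : Type*} [LinearOrder α] {A : α → α → Prop} {W M : Set α}
    (hM : Md A W M) {w : α} (hw : w ∈ Hull W M) (hwM : w ∉ M) : ∃ y ∈ M, A w y := by
  by_contra hc
  push Not at hc
  obtain ⟨hwW, ⟨x, hx, hxw⟩, ⟨y, hy, hwy⟩⟩ := hw
  rcases hM.2 w hwW hwM with h | h
  · exact absurd ((h x hx).2 (hc x hx)) (not_lt.2 hxw)
  · exact absurd ((h y hy).2 (hc y hy)) (not_lt.2 hwy)

/-- A vertex with exactly one neighbour in `M` separates it from the rest. -/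
theorem sep {α : Type*} [LinearOrder α] {A : α → α → Prop} {W M : Set α}
    (hM : Md A W M) {v y : α} (hv : v ∈ W) (hvM : v ∉ M) (hy : y ∈ M) (hA : A v y)
    (hu : ∀ z ∈ M, A v z → z = y) :
    (y < v ∧ ∀ z ∈ M, z ≠ y → v < z) ∨ (v < y ∧ ∀ z ∈ M, z ≠ y → z < v) := by
  have hne : v ≠ y := fun h => hvM (h ▸ hy)
  rcases hM.2 v hv hvM with h | h
  · left
    refine ⟨?_, fun z hz hzy => (h z hz).2 fun ha => hzy (hu z hz ha)⟩
    have := h y hy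
    exact lt_of_le_of_ne (not_lt.1 fun hh => (this.1 hh) hA) hne.symm
  · right
    refine ⟨?_, fun z hz hzy => (h z hz).2 fun ha => hzy (hu z hz ha)⟩
    have := h y hy
    exact lt_of_le_of_ne (not_lt.1 fun hh => (this.1 hh) hA) hne

theorem nontriv {α : Type*} {W M : Set α} (h : ¬ IsTrivialSubset W M) (hMW : M ⊆ W) :
    (∃ x ∈ M, ∃ y ∈ M, x ≠ y) ∧ ∃ v ∈ W, v ∉ M := by
  unfold IsTrivialSubset at h
  push Not at h
  obtain ⟨h1, h2, h3⟩ := h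
  obtain ⟨x, hx⟩ := h1
  refine ⟨⟨x, hx, ?_⟩, ?_⟩
  · by_contra hc
    push Not at hc
    exact h2 x (Set.eq_singleton_iff_unique_mem.2 ⟨hx, fun y hy => (hc y hy).symm⟩)
  · by_contra hc
    push Not at hc
    exact h3 (Set.Subset.antisymm hMW hc)

theorem triv_two {α : Type*} {W M : Set α} (h : IsTrivialSubset W M) {x y : α}
    (hx : x ∈ M) (hy : y ∈ M) (hxy : x ≠ y) : M = W := by
  rcases h with h | ⟨a, h⟩ | h
  · subst h; exact hx.elim
  · subst h; exact (hxy (hx.trans hy.symm)).elim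
  · exact h

/-- If neighbourhoods have at most two elements, a dominating two-element set is
only possible in small sets. -/
theorem small {α : Type*} {A : α → α → Prop} {W : Set α} {x y p q r s : α}
    (hp : ∀ z, A z x → z = p ∨ z = q) (hr : ∀ z, A z y → z = r ∨ z = s)
    (h : ∀ w ∈ W, w ≠ x → w ≠ y → A w x ∨ A w y) : W.ncard ≤ 6 := by
  classical
  have hs : W ⊆ (({x, y, p, q, r, s} : Finset α) : Set α) := by
    intro w hw
    simp only [Finset.coe_insert, Finset.coe_singleton, Set.mem_insert_iff,
      Set.mem_singleton_iff]
    by_cases h1 : w = x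
    · tauto
    by_cases h2 : w = y
    · tauto
    rcases h w hw h1 h2 with h3 | h3
    · have := hp w h3; tauto
    · have := hr w h3; tauto
  calc W.ncard ≤ _ := Set.ncard_le_ncard hs (Finset.finite_toSet _)
    _ = _ := Set.ncard_coe_finset _
    _ ≤ 6 := Finset.card_le_six

theorem small4 {α : Type*} {A : α → α → Prop} {W : Set α} {x y p r : α}
    (hp : ∀ z ∈ W, A z x → z = p) (hr : ∀ z ∈ W, A z y → z = r)
    (h : ∀ w ∈ W, w ≠ x → w ≠ y → A w x ∨ A w y) : W.ncard ≤ 4 := by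
  classical
  have hs : W ⊆ (({x, y, p, r} : Finset α) : Set α) := by
    intro w hw
    simp only [Finset.coe_insert, Finset.coe_singleton, Set.mem_insert_iff,
      Set.mem_singleton_iff]
    by_cases h1 : w = x
    · tauto
    by_cases h2 : w = y
    · tauto
    rcases h w hw h1 h2 with h3 | h3
    · have := hp w hw h3; tauto
    · have := hr w hw h3; tauto
  calc W.ncard ≤ _ := Set.ncard_le_ncard hs (Finset.finite_toSet _)
    _ = _ := Set.ncard_coe_finset _
    _ ≤ 4 := Finset.card_le_four

/-- The final step: an initial closed pair `{x, v}`. -/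
theorem pair_step {α : Type*} [LinearOrder α] {A : α → α → Prop} {W M : Set α}
    (hs : ∀ x y, A x y → A y x) (hirr : Irr A W) (hM : Md A W M)
    (hH : ∀ w ∈ W, w ∈ Hull W M) {x v a b : α} (hx : x ∈ M) (hv : v ∈ W) (hvM : v ∉ M)
    (hA : A v x) (hxv : x < v) (hsep : ∀ z ∈ M, z ≠ x → v < z)
    (hux : ∀ z ∈ W, A x z → z = v) (huv : ∀ z ∈ W, A v z → z = x)
    (ha : a ∈ M) (hb : b ∈ M) (hax : a ≠ x) (hbx : b ≠ x) (hab : a ≠ b)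
    (huw : ∀ w ∈ W, w ∉ M → ∀ y ∈ M, ∀ z ∈ M, y ≠ x → A w y → A w z → z = y) : False := by
  have hxW := hM.1 hx
  have hI : Itv W {x, v} := by
    refine ⟨by rintro z (rfl | rfl) <;> assumption, fun w hw hwI => ?_⟩
    have hwx : w ≠ x := fun h => hwI (by simp [h])
    have hwv : w ≠ v := fun h => hwI (by simp [h])
    rcases lt_or_gt_of_ne hwx with h | h
    · obtain ⟨_, ⟨m, hm, hmw⟩, _⟩ := hH w hw
      by_cases hmx : m = x
      · exact absurd (hmx ▸ hmw) (not_le.2 h)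
      · exact absurd ((hsep m hm hmx).trans_le hmw) (not_lt.2 (h.trans hxv).le)
    · rcases lt_or_gt_of_ne hwv with h' | h'
      · exfalso
        have hwM : w ∉ M := fun hm => absurd (hsep w hm hwx) (not_lt.2 h'.le)
        obtain ⟨y, hy, hwy⟩ := hull_nbr hM (hH w hw) hwM
        have hyx : y ≠ x := fun e => hwv (hux w hw (hs _ _ (e ▸ hwy)))
        have hvy := hsep y hy hyx
        rcases sep hM hw hwM hy hwy (fun z hz hwz => huw w hw hwM y hy z hz hyx hwy hwz)
          with ⟨h1, _⟩ | ⟨_, h2⟩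
        · exact absurd (h1.trans h') (not_lt.2 hvy.le)
        · by_cases hay : a = y
          · have hby : b ≠ y := fun e => hab (hay.trans e.symm)
            exact absurd ((hsep b hb hbx).trans (h2 b hb hby)) (not_lt.2 h'.le)
          · exact absurd ((hsep a ha hax).trans (h2 a ha hay)) (not_lt.2 h'.le)
      · right
        rintro i (rfl | rfl) <;> assumption
  have hC : Cl A W {x, v} := by
    rintro z (rfl | rfl) y hy hzy
    · right; exact hux y hy hzy
    · left; exact huv y hy hzy
  have := triv_two (hirr _ hI hC) (Set.mem_insert x _) (Set.mem_insert_of_mem _ rfl) hxv.ne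
  have haW := hM.1 ha
  rw [← this] at haW
  rcases haW with h | h
  · exact hax h
  · exact hvM (h ▸ ha)

/-- Irreducible pairings on at least five elements give indecomposable tournaments. -/
theorem pairing_indec {α : Type*} [LinearOrder α] {A : α → α → Prop} {W : Set α}
    (hs : ∀ x y, A x y → A y x)
    (hu : ∀ x ∈ W, ∀ y ∈ W, ∀ z ∈ W, A x y → A x z → y = z)
    (hcard : 5 ≤ W.ncard) (hirr : Irr A W) {M : Set α} (hM : Md A W M) :
    IsTrivialSubset W M := by
  by_contra hnt
  have hMW := hM.1
  obtain ⟨⟨a, ha, b, hb, hab⟩, v, hvW, hvM⟩ := nontriv hnt hMW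
  have hC : Cl A W (Hull W M) := by
    intro w hw z hz hwz
    by_cases hwM : w ∈ M
    · by_cases hzM : z ∈ M
      · exact sub_hull hMW hzM
      · obtain ⟨e, he, hew⟩ : ∃ e ∈ M, e ≠ w := by
          by_cases h : a = w
          · exact ⟨b, hb, fun h' => hab (h.trans h'.symm)⟩
          · exact ⟨a, ha, h⟩
        rcases sep hM hz hzM hwM (hs _ _ hwz)
          (fun u hu' hzu => hu z hz u (hMW hu') w (hMW hwM) hzu (hs _ _ hwz))
          with ⟨h1, h2⟩ | ⟨h1, h2⟩
        · exact ⟨hz, ⟨w, hwM, h1.le⟩, e, he, (h2 e he hew).le⟩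
        · exact ⟨hz, ⟨e, he, (h2 e he hew).le⟩, w, hwM, h1.le⟩
    · obtain ⟨y, hy, hwy⟩ := hull_nbr hM hw hwM
      have := hu w hw.1 y (hMW hy) z hz hwy hwz
      exact sub_hull hMW (this ▸ hy)
  have hHW := triv_two (hirr _ (hull_itv W M) hC) (sub_hull hMW ha) (sub_hull hMW hb) hab
  have hH : ∀ w ∈ W, w ∈ Hull W M := fun w hw => hHW.symm ▸ hw
  -- three elements
  have h3 : ∀ x ∈ M, ∃ a ∈ M, ∃ b ∈ M, a ≠ x ∧ b ≠ x ∧ a ≠ b := by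
    intro x hx
    by_contra hc
    push Not at hc
    obtain ⟨y, hy, hyx⟩ : ∃ e ∈ M, e ≠ x := by
      by_cases h : a = x
      · exact ⟨b, hb, fun h' => hab (h.trans h'.symm)⟩
      · exact ⟨a, ha, h⟩
    have hU : ∀ x ∈ W, ∃ p, ∀ z ∈ W, A z x → z = p := by
      intro x hx
      by_cases h : ∃ p ∈ W, A p x
      · obtain ⟨p, hp, hpx⟩ := h
        exact ⟨p, fun z hz hzx => hu x hx z hz p hp (hs _ _ hzx) (hs _ _ hpx)⟩
      · push Not at h
        exact ⟨x, fun z hz hzx => absurd hzx (h z hz)⟩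
    obtain ⟨p, hp⟩ := hU x (hMW hx)
    obtain ⟨r, hr⟩ := hU y (hMW hy)
    have : W.ncard ≤ 4 := by
      refine small4 hp hr fun w hw hwx hwy => ?_
      have hwM : w ∉ M := fun h => hwy (hc y hy w h hyx hwx).symm
      obtain ⟨u, hu', hwu⟩ := hull_nbr hM (hH w hw) hwM
      by_cases hux : u = x
      · left; exact hux ▸ hwu
      · right; rw [hc y hy u hu' hyx hux]; exact hwu
    omega
  obtain ⟨x, hx, hvx⟩ := hull_nbr hM (hH v hvW) hvM
  obtain ⟨a', ha', b', hb', h1, h2, h4⟩ := h3 x hx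
  have hux : ∀ z ∈ W, A x z → z = v := fun z hz h => hu x (hMW hx) z hz v hvW h (hs _ _ hvx)
  have huv : ∀ z ∈ W, A v z → z = x := fun z hz h => hu v hvW z hz x (hMW hx) h hvx
  have huw : ∀ w ∈ W, w ∉ M → ∀ y ∈ M, ∀ z ∈ M, y ≠ x → A w y → A w z → z = y :=
    fun w hw _ y hy z hz _ h h' => hu w hw z (hMW hz) y (hMW hy) h' h
  rcases sep hM hvW hvM hx hvx (fun z hz h => huv z (hMW hz) h) with ⟨h5, h6⟩ | ⟨h5, h6⟩
  · exact pair_step hs hirr hM hH hx hvW hvM hvx h5 h6 hux huv ha' hb' h1 h2 h4 huw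
  · exact @pair_step αᵒᵈ _ A W M hs (irr_dual.2 hirr) (md_dual.2 hM)
      (fun w hw => ⟨hw, (hH w hw).2.2, (hH w hw).2.1⟩) x v a' b' hx hvW hvM hvx h5 h6 hux huv
      ha' hb' h1 h2 h4 huw

/-- Quasi-pairing data in terms of the adjacency relation. -/
structure QP {α : Type*} (A : α → α → Prop) (V : Set α) (h c d : α) : Prop where
  symm : ∀ x y, A x y → A y x
  irr : ∀ x y, A x y → x ≠ y
  mem : ∀ x y, A x y → x ∈ V
  uniq : ∀ x y z, x ≠ h → A x y → A x z → y = z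
  hc : A h c
  hd : A h d
  cd : c ≠ d
  hh : ∀ y, A h y → y = c ∨ y = d

theorem QP.swap {α : Type*} {A : α → α → Prop} {V : Set α} {h c d : α} (H : QP A V h c d) :
    QP A V h d c :=
  ⟨H.symm, H.irr, H.mem, H.uniq, H.hd, H.hc, H.cd.symm, fun y hy => (H.hh y hy).symm⟩

/-- Deleting `c` keeps irreducibility for interval reasons. -/
def Good {α : Type*} [LinearOrder α] (A : α → α → Prop) (V : Set α) (h c : α) : Prop :=
  ∀ I, Itv (V \ {c}) I → Cl A (V \ {c}) I →
    (h ∈ I → Itv V (insert c I)) ∧ (h ∉ I → Itv V I)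

theorem good_dual {α : Type*} [LinearOrder α] {A : α → α → Prop} {V : Set α} {h c : α} :
    @Good αᵒᵈ _ A V h c ↔ Good A V h c := by
  have e : ∀ X I : Set α, @Itv αᵒᵈ _ X I ↔ @Itv α _ X I := fun X I => itv_dual
  constructor
  · intro H I hI hC
    have K := H I ((e _ _).2 hI) hC
    exact ⟨fun hh => (e _ _).1 (K.1 hh), fun hh => (e _ _).1 (K.2 hh)⟩
  · intro H I hI hC
    have K := H I ((e _ _).1 hI) hC
    exact ⟨fun hh => (e _ _).2 (K.1 hh), fun hh => (e _ _).2 (K.2 hh)⟩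

theorem good_irr {α : Type*} [LinearOrder α] {A : α → α → Prop} {V : Set α} {h c d : α}
    (H : QP A V h c d) (hirr : Irr A V) (hg : Good A V h c) : Irr A (V \ {c}) := by
  intro I hI hC
  obtain ⟨h1, h2⟩ := hg I hI hC
  have hcI : c ∉ I := fun hc => (hI.1 hc).2 rfl
  have hcuniq : ∀ y, A c y → y = h := fun y hy =>
    H.uniq c y h (H.irr _ _ H.hc).symm hy (H.symm _ _ H.hc)
  by_cases hh : h ∈ I
  · have h3 := h1 hh
    have : Cl A V (insert c I) := by
      rintro x (rfl | hx) y hy hxy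
      · right; rw [hcuniq y hxy]; exact hh
      · by_cases hyc : y = c
        · left; exact hyc
        · right; exact hC x hx y ⟨hy, hyc⟩ hxy
    have h4 := triv_two (hirr _ h3 this) (Set.mem_insert c I) (Set.mem_insert_of_mem c hh)
      (H.irr _ _ H.hc).symm
    right; right
    rw [← h4]
    ext z
    simp only [Set.mem_diff, Set.mem_insert_iff, Set.mem_singleton_iff]
    constructor
    · exact fun hz => ⟨Or.inr hz, fun e => hcI (e ▸ hz)⟩
    · rintro ⟨e | e, hz⟩
      · exact absurd e hz
      · exact e
  · have h3 := h2 hh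
    have : Cl A V I := by
      intro x hx y hy hxy
      by_cases hyc : y = c
      · subst hyc
        exact absurd ((hcuniq x (H.symm _ _ hxy)) ▸ hx) hh
      · exact hC x hx y ⟨hy, hyc⟩ hxy
    rcases hirr _ h3 this with h4 | h4 | h4
    · left; exact h4
    · right; left; exact h4
    · exact absurd (h4 ▸ H.mem _ _ (H.symm _ _ H.hc)) hcI

theorem good_consec {α : Type*} [LinearOrder α] {A : α → α → Prop} {V : Set α} {h c d e : α}
    (H : QP A V h c d) (he : e = h ∨ e = d)
    (hno : ∀ w ∈ V, ¬ (c < w ∧ w < e) ∧ ¬ (e < w ∧ w < c)) : Good A V h c := by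
  intro I hI hC
  have hcV : c ∈ V := H.mem _ _ (H.symm _ _ H.hc)
  have hhV : h ∈ V := H.mem _ _ H.hc
  have hdV : d ∈ V := H.mem _ _ (H.symm _ _ H.hd)
  have hhc := H.irr _ _ H.hc
  have hhd := H.irr _ _ H.hd
  have hcd := H.cd
  have heh : e ∈ I ↔ h ∈ I := by
    rcases he with rfl | rfl
    · rfl
    · exact ⟨fun hi => hC _ hi h ⟨hhV, hhc⟩ (H.symm _ _ H.hd),
        fun hi => hC _ hi _ ⟨hdV, hcd.symm⟩ H.hd⟩
  have heV : e ∈ V := by rcases he with rfl | rfl <;> assumption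
  have hec : e ≠ c := by rcases he with rfl | rfl; exacts [hhc, hcd.symm]
  rw [← heh]
  refine ⟨fun heI => ⟨?_, ?_⟩, fun heI => ⟨fun x hx => (hI.1 hx).1, ?_⟩⟩
  · rintro x (rfl | hx)
    · exact hcV
    · exact (hI.1 hx).1
  · intro v hv hvI
    have hvc : v ≠ c := fun e => hvI (by simp [e])
    have hvI' : v ∉ I := fun h => hvI (Set.mem_insert_of_mem c h)
    have hn := hno v hv
    rcases hI.2 v ⟨hv, hvc⟩ hvI' with h1 | h1
    · left
      rintro i (rfl | hi)
      · have := h1 e heI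
        rcases lt_or_gt_of_ne hvc with h | h
        · exact h
        · exact absurd ⟨h, this⟩ hn.1
      · exact h1 i hi
    · right
      rintro i (rfl | hi)
      · have := h1 e heI
        rcases lt_or_gt_of_ne hvc with h | h
        · exact absurd ⟨this, h⟩ hn.2
        · exact h
      · exact h1 i hi
  · intro v hv hvI
    by_cases hvc : v = c
    · subst hvc
      rcases hI.2 e ⟨heV, hec⟩ heI with h1 | h1
      · left
        intro i hi
        have h2 := h1 i hi
        have h3 := hno i (hI.1 hi).1
        by_contra h4
        exact h3.2 ⟨h2, lt_of_le_of_ne (not_lt.1 h4) (hI.1 hi).2⟩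
      · right
        intro i hi
        have h2 := h1 i hi
        have h3 := hno i (hI.1 hi).1
        by_contra h4
        exact h3.1 ⟨lt_of_le_of_ne (not_lt.1 h4) (Ne.symm (hI.1 hi).2), h2⟩
    · exact hI.2 v ⟨hv, hvc⟩ hvI

/-- Case 3: `h` outside `M`, `c ∈ M`, `d ∉ M`. -/
theorem case3 {α : Type*} [LinearOrder α] {A : α → α → Prop} {V M : Set α} {h c d : α}
    (H : QP A V h c d) (hM : Md A V M) (hhM : h ∉ M) (hcM : c ∈ M)
    {b : α} (hb : b ∈ M) (hbc : b ≠ c)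
    (hch : c < h) (hsep : ∀ z ∈ M, z ≠ c → h < z) : Good A V h c := by
  have hMV := hM.1
  have hcV : c ∈ V := H.mem _ _ (H.symm _ _ H.hc)
  have hhV : h ∈ V := H.mem _ _ H.hc
  have hdV : d ∈ V := H.mem _ _ (H.symm _ _ H.hd)
  have hcuniq : ∀ y, A y c → y = h := fun y hy =>
    H.uniq c y h (H.irr _ _ H.hc).symm (H.symm _ _ hy) (H.symm _ _ H.hc)
  have key : ∀ w ∈ V, c < w → w < h → ∃ y ∈ M, y ≠ c ∧ A w y ∧ w < y ∧ ∀ z ∈ M, z ≠ y → z < w := by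
    intro w hw h1 h2
    have hwM : w ∉ M := fun hm => absurd (hsep w hm h1.ne') (not_lt.2 h2.le)
    have hwH : w ∈ Hull V M :=
      ⟨hw, ⟨c, hcM, h1.le⟩, b, hb, (h2.trans (hsep b hb hbc)).le⟩
    obtain ⟨y, hy, hwy⟩ := hull_nbr hM hwH hwM
    have hyc : y ≠ c := fun e => h2.ne (hcuniq w (e ▸ hwy))
    refine ⟨y, hy, hyc, hwy, ?_⟩
    rcases sep hM hw hwM hy hwy (fun z hz hz' => H.uniq w z y h2.ne hz' hwy) with ⟨h3, _⟩ | h3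
    · exact absurd (h3.trans h2) (not_lt.2 (hsep y hy hyc).le)
    · exact h3
  by_cases hno : ∃ w ∈ V, c < w ∧ w < h
  · obtain ⟨w, hw, hcw, hwh⟩ := hno
    obtain ⟨y, hy, hyc, hwy, hwy', hy'⟩ := key w hw hcw hwh
    have hhy := hsep y hy hyc
    have hMeq : ∀ z ∈ M, z = c ∨ z = y := by
      intro z hz
      by_contra hc
      push Not at hc
      exact absurd ((hy' z hz hc.2).trans hwh) (not_lt.2 (hsep z hz hc.1).le)
    have hyh : y ≠ h := hhy.ne'
    have hbetw : ∀ u ∈ V, c < u → u < y → u = w ∨ u = h := by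
      intro u hu h1 h2
      have huM : u ∉ M := fun hm => by
        rcases hMeq u hm with e | e
        · exact h1.ne' e
        · exact h2.ne e
      obtain ⟨z, hz, huz⟩ := hull_nbr hM ⟨hu, ⟨c, hcM, h1.le⟩, y, hy, h2.le⟩ huM
      rcases hMeq z hz with e | e
      · right; exact hcuniq u (e ▸ huz)
      · left; subst e
        exact H.uniq z u w hyh (H.symm _ _ huz) (H.symm _ _ hwy)
    intro I hI hC
    have hyV := hMV hy
    have hwI : w ∈ I ↔ y ∈ I :=
      ⟨fun hi => hC w hi y ⟨hyV, hyc⟩ hwy, fun hi => hC y hi w ⟨hw, hcw.ne'⟩ (H.symm _ _ hwy)⟩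
    refine ⟨fun hhI => ⟨?_, ?_⟩, fun hhI => ⟨fun x hx => (hI.1 hx).1, ?_⟩⟩
    · rintro x (rfl | hx)
      · exact hcV
      · exact (hI.1 hx).1
    · intro v hv hvI
      have hvc : v ≠ c := fun e => hvI (by simp [e])
      have hvI' : v ∉ I := fun h => hvI (Set.mem_insert_of_mem c h)
      rcases hI.2 v ⟨hv, hvc⟩ hvI' with h1 | h1
      · left
        rintro i (rfl | hi)
        · by_contra hlt
          have hcv := lt_of_le_of_ne (not_lt.1 hlt) hvc.symm
          have hvh := h1 h hhI
          have hvw : v = w := by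
            rcases hbetw v hv hcv (hvh.trans hhy) with e | e
            · exact e
            · exact absurd e hvh.ne
          subst hvw
          have hyI : y ∉ I := fun hh => hvI' (hwI.2 hh)
          have hdI : d ∈ I := hC h hhI d ⟨hdV, H.cd.symm⟩ H.hd
          have h5 : d < y := by
            rcases hI.2 y ⟨hyV, hyc⟩ hyI with h6 | h6
            · exact absurd (h6 h hhI) (not_lt.2 hhy.le)
            · exact h6 d hdI
          rcases hbetw d hdV (hcv.trans (h1 d hdI)) h5 with e | e
          · exact hvI' (e ▸ hdI)
          · exact H.irr _ _ H.hd e.symm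
        · exact h1 i hi
      · right
        rintro i (rfl | hi)
        · exact hch.trans (h1 h hhI)
        · exact h1 i hi
    · intro v hv hvI
      by_cases hvc : v = c
      · subst hvc
        rcases hI.2 h ⟨hhV, hch.ne'⟩ hhI with h1 | h1
        · left
          intro i hi
          exact hch.trans (h1 i hi)
        · right
          intro i hi
          by_contra h4
          have h5 := lt_of_le_of_ne (not_lt.1 h4) (Ne.symm (hI.1 hi).2)
          have h6 := h1 i hi
          rcases hbetw i (hI.1 hi).1 h5 (h6.trans hhy) with e | e
          · have := hwI.1 (e ▸ hi)
            exact absurd (h1 y this) (not_lt.2 hhy.le)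
          · exact h6.ne e
      · exact hI.2 v ⟨hv, hvc⟩ hvI
  · push Not at hno
    refine good_consec H (Or.inl rfl) fun w hw => ⟨fun hh => absurd hh.2 (not_lt.2 (hno w hw hh.1)),
      fun hh => absurd (hh.1.trans hh.2) (not_lt.2 hch.le)⟩

/-- Case 2b: `h ∈ M` and a vertex outside `M` adjacent to `h`. -/
theorem case2b {α : Type*} [LinearOrder α] {A : α → α → Prop} {V M : Set α} {h c d : α}
    (H : QP A V h c d) (hM : Md A V M) (hhM : h ∈ M)
    (hH : ∀ w ∈ V, w ∈ Hull V M) {a b : α} (ha : a ∈ M) (hb : b ∈ M)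
    (hah : a ≠ h) (hbh : b ≠ h) (hab : a ≠ b)
    (hhc : h < c) (hsep : ∀ z ∈ M, z ≠ h → c < z) : Good A V h c ∨ Good A V h d := by
  have key : ∀ w ∈ V, h < w → w < c → w = d := by
    intro w hw h1 h2
    have hwM : w ∉ M := fun hm => absurd (hsep w hm h1.ne') (not_lt.2 h2.le)
    obtain ⟨y, hy, hwy⟩ := hull_nbr hM (hH w hw) hwM
    by_cases hyh : y = h
    · subst hyh
      rcases H.hh w (H.symm _ _ hwy) with e | e
      · exact absurd e h2.ne
      · exact e
    · exfalso
      have hcy := hsep y hy hyh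
      rcases sep hM hw hwM hy hwy (fun z hz hz' => H.uniq w z y h1.ne' hz' hwy)
        with ⟨h3, _⟩ | ⟨_, h3⟩
      · exact absurd (h3.trans h2) (not_lt.2 hcy.le)
      · by_cases hay : a = y
        · have hby : b ≠ y := fun e => hab (hay.trans e.symm)
          exact absurd ((hsep b hb hbh).trans (h3 b hb hby)) (not_lt.2 h2.le)
        · exact absurd ((hsep a ha hah).trans (h3 a ha hay)) (not_lt.2 h2.le)
  by_cases hd : h < d ∧ d < c
  · right
    refine good_consec H.swap (Or.inl rfl) fun w hw => ⟨fun hh => ?_, fun hh => ?_⟩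
    · exact absurd (hh.1.trans hh.2) (not_lt.2 hd.1.le)
    · exact hh.2.ne (key w hw hh.1 (hh.2.trans hd.2))
  · left
    refine good_consec H (Or.inl rfl) fun w hw => ⟨fun hh => ?_, fun hh => ?_⟩
    · exact absurd (hh.1.trans hh.2) (not_lt.2 hhc.le)
    · have := key w hw hh.1 hh.2
      subst this
      exact hd hh

/-- Case 2a (also covers `M = {c, d}`): both neighbours of `h ∉ M` are in `M`. -/
theorem case2a {α : Type*} [LinearOrder α] {A : α → α → Prop} {V M : Set α} {h c d : α}
    (H : QP A V h c d) (hM : Md A V M) (hhM : h ∉ M) (hcM : c ∈ M) (hdM : d ∈ M) :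
    Good A V h c := by
  have hMV := hM.1
  have hhV : h ∈ V := H.mem _ _ H.hc
  have hcu : ∀ y, A y c → y = h := fun y hy =>
    H.uniq c y h (H.irr _ _ H.hc).symm (H.symm _ _ hy) (H.symm _ _ H.hc)
  have hdu : ∀ y, A y d → y = h := fun y hy =>
    H.uniq d y h (H.irr _ _ H.hd).symm (H.symm _ _ hy) (H.symm _ _ H.hd)
  have hne : h ≠ c := H.irr _ _ H.hc
  have hned : h ≠ d := H.irr _ _ H.hd
  have hcd := H.cd
  have hHc := H.hc
  have hHd := H.hd
  -- no element between
  have key : ∀ w ∈ V, ∀ x y, (x = c ∧ y = d ∨ x = d ∧ y = c) → x < w → w < y → False := by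
    intro w hw x y hxy h1 h2
    have hx : x ∈ M := by rcases hxy with ⟨rfl, rfl⟩ | ⟨rfl, rfl⟩ <;> assumption
    have hy : y ∈ M := by rcases hxy with ⟨rfl, rfl⟩ | ⟨rfl, rfl⟩ <;> assumption
    have hAx : A h x := by rcases hxy with ⟨rfl, rfl⟩ | ⟨rfl, rfl⟩ <;> assumption
    have hAy : A h y := by rcases hxy with ⟨rfl, rfl⟩ | ⟨rfl, rfl⟩ <;> assumption
    have hux : ∀ z, A z x → z = h := by rcases hxy with ⟨rfl, rfl⟩ | ⟨rfl, rfl⟩ <;> assumption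
    have huy : ∀ z, A z y → z = h := by rcases hxy with ⟨rfl, rfl⟩ | ⟨rfl, rfl⟩ <;> assumption
    have hhu : ∀ z, A h z → z = x ∨ z = y := by
      intro z hz
      have := H.hh z hz
      rcases hxy with ⟨rfl, rfl⟩ | ⟨rfl, rfl⟩ <;> tauto
    have hxh := H.irr _ _ hAx
    have hyh := H.irr _ _ hAy
    have hmod := hM.2 h hhV hhM
    -- h is not strictly between x and y
    have hwh : w ≠ h := by
      rintro rfl
      rcases hmod with h3 | h3
      · exact (h3 y hy).1 h2 hAy
      · exact (h3 x hx).1 h1 hAx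
    have hwM : w ∉ M := by
      intro hm
      have hnA : ¬ A h w := fun hA => by
        rcases hhu w hA with e | e
        · exact h1.ne' e
        · exact h2.ne e
      rcases hmod with h3 | h3
      · exact (h3 y hy).1 (((h3 w hm).2 hnA).trans h2) hAy
      · exact (h3 x hx).1 (h1.trans ((h3 w hm).2 hnA)) hAx
    obtain ⟨z, hz, hwz⟩ := hull_nbr hM ⟨hw, ⟨x, hx, h1.le⟩, y, hy, h2.le⟩ hwM
    have hzx : z ≠ x := fun e => hwh (hux w (e ▸ hwz))
    have hzy : z ≠ y := fun e => hwh (huy w (e ▸ hwz))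
    rcases sep hM hw hwM hz hwz (fun u hu hu' => H.uniq w u z hwh hu' hwz)
      with ⟨_, h3⟩ | ⟨_, h3⟩
    · exact absurd (h3 x hx hzx.symm) (not_lt.2 h1.le)
    · exact absurd (h3 y hy hzy.symm) (not_lt.2 h2.le)
  refine good_consec H (Or.inr rfl) fun w hw => ⟨fun hh => ?_, fun hh => ?_⟩
  · exact key w hw c d (Or.inl ⟨rfl, rfl⟩) hh.1 hh.2
  · exact key w hw d c (Or.inr ⟨rfl, rfl⟩) hh.1 hh.2

theorem case3' {α : Type*} [LinearOrder α] {A : α → α → Prop} {V M : Set α} {h c d : α}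
    (H : QP A V h c d) (hM : Md A V M) (hhM : h ∉ M) (hcM : c ∈ M) (hdM : d ∉ M)
    {b : α} (hb : b ∈ M) (hbc : b ≠ c) : Good A V h c := by
  rcases sep hM (H.mem _ _ H.hc) hhM hcM H.hc (fun z hz hz' => by
    rcases H.hh z hz' with e | e
    · exact e
    · exact absurd (e ▸ hz) hdM) with ⟨h1, h2⟩ | ⟨h1, h2⟩
  · exact case3 H hM hhM hcM hb hbc h1 h2
  · exact good_dual.1 (@case3 αᵒᵈ _ A V M h c d H (md_dual.2 hM) hhM hcM b hb hbc h1 h2)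

theorem main_case {α : Type*} [LinearOrder α] {A : α → α → Prop} {V M : Set α} {h c d : α}
    (H : QP A V h c d) (hcard : 7 ≤ V.ncard) (hirr : Irr A V) (hM : Md A V M)
    (hnt : ¬ IsTrivialSubset V M) : Good A V h c ∨ Good A V h d := by
  have hMW := hM.1
  obtain ⟨⟨a, ha, b, hb, hab⟩, v, hvW, hvM⟩ := nontriv hnt hMW
  have hother : ∀ x, ∃ e ∈ M, e ≠ x := by
    intro x
    by_cases hx : a = x
    · exact ⟨b, hb, fun h' => hab (hx.trans h'.symm)⟩
    · exact ⟨a, ha, hx⟩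
  by_cases hspec : h ∉ M ∧ (c ∈ M ∨ d ∈ M)
  · obtain ⟨hhM, hcd⟩ := hspec
    by_cases hcM : c ∈ M
    · left
      by_cases hdM : d ∈ M
      · exact case2a H hM hhM hcM hdM
      · obtain ⟨e, he, hec⟩ := hother c
        exact case3' H hM hhM hcM hdM he hec
    · right
      have hdM := hcd.resolve_left hcM
      obtain ⟨e, he, hec⟩ := hother d
      exact case3' H.swap hM hhM hdM hcM he hec
  -- now a vertex outside `M` with a neighbour in `M` is not `h`
  have hnh : ∀ w, w ∉ M → ∀ y ∈ M, A w y → w ≠ h := by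
    rintro w hw y hy hwy rfl
    refine hspec ⟨hw, ?_⟩
    rcases H.hh y hwy with rfl | rfl
    · exact Or.inl hy
    · exact Or.inr hy
  have hmem2 : ∀ x y, A x y → y ∈ V := fun x y hxy => H.mem _ _ (H.symm _ _ hxy)
  have hC : Cl A V (Hull V M) := by
    intro w hw z hz hwz
    by_cases hwM : w ∈ M
    · by_cases hzM : z ∈ M
      · exact sub_hull hMW hzM
      · obtain ⟨e, he, hew⟩ := hother w
        have hzw := H.symm _ _ hwz
        have hzh := hnh z hzM w hwM hzw
        rcases sep hM hz hzM hwM hzw (fun u _ hzu => H.uniq z u w hzh hzu hzw)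
          with ⟨h1, h2⟩ | ⟨h1, h2⟩
        · exact ⟨hz, ⟨w, hwM, h1.le⟩, e, he, (h2 e he hew).le⟩
        · exact ⟨hz, ⟨e, he, (h2 e he hew).le⟩, w, hwM, h1.le⟩
    · obtain ⟨y, hy, hwy⟩ := hull_nbr hM hw hwM
      have := H.uniq w y z (hnh w hwM y hy hwy) hwy hwz
      exact sub_hull hMW (this ▸ hy)
  have hHW := triv_two (hirr _ (hull_itv V M) hC) (sub_hull hMW ha) (sub_hull hMW hb) hab
  have hH : ∀ w ∈ V, w ∈ Hull V M := fun w hw => hHW.symm ▸ hw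
  have hHd : ∀ w ∈ V, w ∈ @Hull αᵒᵈ _ V M := fun w hw => ⟨hw, (hH w hw).2.2, (hH w hw).2.1⟩
  have h3 : ∀ x ∈ M, ∃ a ∈ M, ∃ b ∈ M, a ≠ x ∧ b ≠ x ∧ a ≠ b := by
    intro x hx
    by_contra hc
    push Not at hc
    obtain ⟨y, hy, hyx⟩ := hother x
    have hU : ∀ x, ∃ p q, ∀ z, A z x → z = p ∨ z = q := by
      intro x
      by_cases hxh : x = h
      · subst hxh
        exact ⟨c, d, fun z hz => H.hh z (H.symm _ _ hz)⟩
      · by_cases hex : ∃ p, A p x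
        · obtain ⟨p, hpx⟩ := hex
          exact ⟨p, p, fun z hzx => Or.inl (H.uniq x z p hxh (H.symm _ _ hzx) (H.symm _ _ hpx))⟩
        · push Not at hex
          exact ⟨x, x, fun z hzx => absurd hzx (hex z)⟩
    obtain ⟨p, q, hp⟩ := hU x
    obtain ⟨r, s, hr⟩ := hU y
    have : V.ncard ≤ 6 := by
      refine small hp hr fun w hw hwx hwy => ?_
      have hwM : w ∉ M := fun h => hwy (hc y hy w h hyx hwx).symm
      obtain ⟨u, hu', hwu⟩ := hull_nbr hM (hH w hw) hwM
      by_cases hux : u = x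
      · left; exact hux ▸ hwu
      · right; rw [hc y hy u hu' hyx hux]; exact hwu
    omega
  obtain ⟨x, hx, hvx⟩ := hull_nbr hM (hH v hvW) hvM
  obtain ⟨a', ha', b', hb', h1, h2, h4⟩ := h3 x hx
  have hvh := hnh v hvM x hx hvx
  have hsep := sep hM hvW hvM hx hvx (fun z _ hz => H.uniq v z x hvh hz hvx)
  by_cases hxh : x = h
  · subst hxh
    rcases H.hh v (H.symm _ _ hvx) with rfl | rfl
    · rcases hsep with ⟨h5, h6⟩ | ⟨h5, h6⟩
      · exact case2b H hM hx hH ha' hb' h1 h2 h4 h5 h6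
      · have := @case2b αᵒᵈ _ A V M x v d H (md_dual.2 hM) hx hHd a' b' ha' hb' h1 h2 h4 h5 h6
        rwa [good_dual, good_dual] at this
    · rcases hsep with ⟨h5, h6⟩ | ⟨h5, h6⟩
      · exact (case2b H.swap hM hx hH ha' hb' h1 h2 h4 h5 h6).symm
      · have := @case2b αᵒᵈ _ A V M x v c H.swap (md_dual.2 hM) hx hHd a' b' ha' hb' h1 h2 h4
          h5 h6
        rw [good_dual, good_dual] at this
        exact this.symm
  · exfalso
    have hux : ∀ z ∈ V, A x z → z = v := fun z _ h => H.uniq x z v hxh h (H.symm _ _ hvx)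
    have huv : ∀ z ∈ V, A v z → z = x := fun z _ h => H.uniq v z x hvh h hvx
    have huw : ∀ w ∈ V, w ∉ M → ∀ y ∈ M, ∀ z ∈ M, y ≠ x → A w y → A w z → z = y :=
      fun w _ hwM y hy z _ _ h h' => H.uniq w z y (hnh w hwM y hy h) h' h
    rcases hsep with ⟨h5, h6⟩ | ⟨h5, h6⟩
    · exact pair_step H.symm hirr hM hH hx hvW hvM hvx h5 h6 hux huv ha' hb' h1 h2 h4 huw
    · exact @pair_step αᵒᵈ _ A V M H.symm (irr_dual.2 hirr) (md_dual.2 hM)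
        hHd x v a' b' hx hvW hvM hvx h5 h6 hux huv ha' hb' h1 h2 h4 huw

/-- The translation between the two notions of module. -/
theorem md_of_module {α : Type*} [LinearOrder α] {Q : Set (Set α)} {W M : Set α}
    (hM : IsModuleOn Q W M) : Md (fun x y => ({x, y} : Set α) ∈ Q) W M := by
  refine ⟨hM.1, fun v hv hvM => ?_⟩
  rcases hM.2 v hv hvM with h | h
  · left
    intro x hx
    rcases h x hx with ⟨h1, h2⟩ | ⟨h1, h2⟩
    · exact ⟨fun _ => h2, fun _ => h1⟩
    · exact ⟨fun h3 => absurd h3 (not_lt.2 h1.le), fun h3 => absurd h2 h3⟩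
  · right
    intro x hx
    show x < v ↔ ({v, x} : Set α) ∉ Q
    rw [Set.pair_comm]
    rcases h x hx with ⟨h1, h2⟩ | ⟨h1, h2⟩
    · exact ⟨fun _ => h2, fun _ => h1⟩
    · exact ⟨fun h3 => absurd h3 (not_lt.2 h1.le), fun h3 => absurd h2 h3⟩

/-- Counting: for a subfamily `S`, `2|S| ≤ |⋃ S| + 1`. -/
theorem ncard_sUnion_le {α : Type*} (R : Set (Set α)) (hR : R.Finite)
    (h2 : ∀ B ∈ R, B.ncard = 2) : (⋃₀ R).ncard ≤ 2 * R.ncard := by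
  induction R, hR using Set.Finite.induction_on with
  | empty => simp
  | @insert B R hB hR ih =>
    rw [Set.sUnion_insert, Set.ncard_insert_of_notMem hB hR]
    have h1 := Set.ncard_union_le B (⋃₀ R)
    have h3 := ih fun C hC => h2 C (Set.mem_insert_of_mem _ hC)
    have h4 := h2 B (Set.mem_insert _ _)
    omega

theorem count_sub {α : Type*} {V : Set α} {Q : Set (Set α)}
    (hQ : IsPartialQuasiPairingOn V Q) (S : Set (Set α)) (hS : S ⊆ Q) :
    2 * S.ncard ≤ (⋃₀ S).ncard + 1 := by
  obtain ⟨h2, m, hm, h3, h4⟩ := hQ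
  have hfin : Q.Finite := Set.finite_of_ncard_pos (by omega)
  have h5 : ⋃₀ Q = ⋃₀ S ∪ ⋃₀ (Q \ S) := by
    rw [← Set.sUnion_union, Set.union_diff_cancel hS]
  have h6 := Set.ncard_union_le (⋃₀ S) (⋃₀ (Q \ S))
  have h7 := ncard_sUnion_le (Q \ S) hfin.diff fun B hB => (h2 B hB.1).2
  have h8 := Set.ncard_diff_add_ncard_of_subset hS hfin
  rw [← h5] at h6
  omega

theorem qp_of {α : Type*} [LinearOrder α] {V : Set α} {Q : Set (Set α)}
    (hQ : IsPartialQuasiPairingOn V Q) {vh vm vp : α} (hdata : QPData Q vh vm vp) :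
    QP (fun x y => ({x, y} : Set α) ∈ Q) V vh vm vp := by
  classical
  obtain ⟨hm, hp, hlt⟩ := hdata
  have hne : ∀ x y : α, ({x, y} : Set α) ∈ Q → x ≠ y := by
    rintro x y h rfl
    have := (hQ.1 _ h).2
    simp at this
  have hhm := hne _ _ hm
  have hhp := hne _ _ hp
  have hmp := hlt.ne
  -- no further block meets the three points
  have hpe : ∀ x y z w : α, ({x, y} : Set α) = {z, w} → (x = z ∧ y = w) ∨ (x = w ∧ y = z) :=
    fun x y z w h => Set.pair_eq_pair_iff.1 h
  have hS2 : ({vh, vm} : Set α) ≠ {vh, vp} := fun h => by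
    rcases hpe _ _ _ _ h with h | h
    · exact hmp h.2
    · exact hhp h.1
  have hmeet : ∀ x y, ({x, y} : Set α) ∈ Q → x = vh ∨ x = vm ∨ x = vp →
      ({x, y} : Set α) = {vh, vm} ∨ ({x, y} : Set α) = {vh, vp} := by
    intro x y hxy hx
    by_contra hc
    push Not at hc
    have h1 := count_sub hQ {{x, y}, {vh, vm}, {vh, vp}} (by
      rintro B (rfl | rfl | rfl) <;> assumption)
    rw [Set.ncard_eq_three.2 ⟨_, _, _, hc.1, hc.2, hS2, rfl⟩] at h1
    have h2 : (⋃₀ {{x, y}, {vh, vm}, {vh, vp}} : Set α) ⊆ (({y, vh, vm, vp} : Finset α) : Set α) := by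
      intro z hz
      simp at hz ⊢
      rcases hx with rfl | rfl | rfl <;> tauto
    have h3 := Set.ncard_le_ncard h2 (Finset.finite_toSet _)
    rw [Set.ncard_coe_finset] at h3
    have := h3.trans Finset.card_le_four
    omega
  refine ⟨fun x y h => by rw [Set.pair_comm]; exact h, hne, fun x y h => (hQ.1 _ h).1 (by simp),
    ?_, hm, hp, hmp, ?_⟩
  · intro x y z hx hxy hxz
    by_contra hyz
    have hyx := hne _ _ hxy
    have hzx := hne _ _ hxz
    by_cases hx' : x = vm ∨ x = vp
    · have e1 := hmeet x y hxy (Or.inr hx')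
      have e2 := hmeet x z hxz (Or.inr hx')
      have f1 : y = vh := by
        rcases e1 with e | e <;> rcases hpe _ _ _ _ e with h | h
        exacts [absurd h.1 hx, h.2, absurd h.1 hx, h.2]
      have f2 : z = vh := by
        rcases e2 with e | e <;> rcases hpe _ _ _ _ e with h | h
        exacts [absurd h.1 hx, h.2, absurd h.1 hx, h.2]
      exact hyz (f1.trans f2.symm)
    · push Not at hx'
      have n1 : ∀ y, ({x, y} : Set α) ≠ {vh, vm} := fun y h => by
        rcases hpe _ _ _ _ h with h | h
        exacts [hx h.1, hx'.1 h.1]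
      have n2 : ∀ y, ({x, y} : Set α) ≠ {vh, vp} := fun y h => by
        rcases hpe _ _ _ _ h with h | h
        exacts [hx h.1, hx'.2 h.1]
      have n3 : ({x, y} : Set α) ≠ {x, z} := fun h => by
        rcases hpe _ _ _ _ h with h | h
        exacts [hyz h.2, hzx h.1]
      have h1 := count_sub hQ {{x, y}, {x, z}, {vh, vm}, {vh, vp}} (by
        rintro B (rfl | rfl | rfl | rfl) <;> assumption)
      rw [Set.ncard_insert_of_notMem (by
          simp only [Set.mem_insert_iff, Set.mem_singleton_iff]
          exact fun h => h.elim n3 fun h => h.elim (n1 y) (n2 y)) (by simp),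
        Set.ncard_eq_three.2 ⟨_, _, _, n1 z, n2 z, hS2, rfl⟩] at h1
      have h2 : (⋃₀ {{x, y}, {x, z}, {vh, vm}, {vh, vp}} : Set α) ⊆
          (({x, y, z, vh, vm, vp} : Finset α) : Set α) := by
        intro z hz
        simp at hz ⊢
        tauto
      have h3 := Set.ncard_le_ncard h2 (Finset.finite_toSet _)
      rw [Set.ncard_coe_finset] at h3
      have := h3.trans Finset.card_le_six
      omega
  · intro y hy
    rcases hmeet vh y hy (Or.inl rfl) with e | e <;> rcases hpe _ _ _ _ e with h | h
    exacts [Or.inl h.2, absurd h.1 hhm, Or.inr h.2, absurd h.1 hhp]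

/-- Irreducibility in terms of adjacency. -/
theorem irr_of {α : Type*} [LinearOrder α] {V : Set α} {Q : Set (Set α)}
    (hQ : IsPartialQuasiPairingOn V Q) (hcover : ⋃₀ Q = V)
    {vh vm vp : α} (H : QP (fun x y => ({x, y} : Set α) ∈ Q) V vh vm vp)
    (hirr : IrreducibleOn V (QPart Q vh vm vp)) :
    Irr (fun x y => ({x, y} : Set α) ∈ Q) V := by
  intro I hI hC
  by_contra hnt
  have hhV : vh ∈ V := H.mem _ _ H.hc
  have hmV : vm ∈ V := H.mem _ _ (H.symm _ _ H.hc)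
  have hpV : vp ∈ V := H.mem _ _ (H.symm _ _ H.hd)
  have hB : (vh ∈ I ∨ vm ∈ I ∨ vp ∈ I) → ({vh, vm, vp} : Set α) ⊆ I := by
    intro h
    have hh : vh ∈ I := by
      rcases h with h | h | h
      · exact h
      · exact hC _ h _ hhV (H.symm _ _ H.hc)
      · exact hC _ h _ hhV (H.symm _ _ H.hd)
    rintro z (rfl | rfl | rfl)
    · exact hh
    · exact hC _ hh _ hmV H.hc
    · exact hC _ hh _ hpV H.hd
  have heq : ⋃₀ {B | B ∈ QPart Q vh vm vp ∧ B ⊆ I} = I := by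
    apply Set.Subset.antisymm
    · rintro x ⟨B, ⟨_, hB⟩, hx⟩
      exact hB hx
    · intro x hx
      by_cases hxB : x = vh ∨ x = vm ∨ x = vp
      · refine ⟨{vh, vm, vp}, ⟨Or.inr rfl, hB ?_⟩, hxB⟩
        rcases hxB with rfl | rfl | rfl
        · exact Or.inl hx
        · exact Or.inr (Or.inl hx)
        · exact Or.inr (Or.inr hx)
      · have hxV : x ∈ ⋃₀ Q := hcover ▸ hI.1 hx
        obtain ⟨B, hBQ, hxB'⟩ := hxV
        refine ⟨B, ⟨Or.inl ⟨hBQ, ?_⟩, ?_⟩, hxB'⟩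
        · rintro (rfl | rfl)
          · rcases hxB' with h | h
            exacts [hxB (Or.inl h), hxB (Or.inr (Or.inl h))]
          · rcases hxB' with h | h
            exacts [hxB (Or.inl h), hxB (Or.inr (Or.inr h))]
        · obtain ⟨p, q, hpq, rfl⟩ := Set.ncard_eq_two.1 (hQ.1 B hBQ).2
          have hpq' := (hQ.1 _ hBQ).1
          rcases hxB' with rfl | rfl
          · rintro z (rfl | rfl)
            · exact hx
            · exact hC _ hx _ (hpq' (by simp)) hBQ
          · rintro z (rfl | rfl)
            · exact hC _ hx _ (hpq' (by simp)) (H.symm _ _ hBQ)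
            · exact hx
  refine hirr {B | B ∈ QPart Q vh vm vp ∧ B ⊆ I} (fun B hB => hB.1) ?_
  rw [heq]
  exact ⟨⟨hI.1, fun v hv => hI.2 v hv.1 hv.2⟩, hnt⟩

/-- Closed intervals are modules of every induced subtournament. -/
theorem module_of {α : Type*} [LinearOrder α] {V : Set α} {Q : Set (Set α)}
    (hQ : IsPartialQuasiPairingOn V Q)
    {vh vm vp : α} (H : QP (fun x y => ({x, y} : Set α) ∈ Q) V vh vm vp)
    {R : Set (Set α)} (hR : R ⊆ QPart Q vh vm vp) (hI : IsIntervalOf V (⋃₀ R))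
    {W : Set α} (hW : W ⊆ V) : IsModuleOn Q W (⋃₀ R ∩ W) := by
  have hcl : ∀ x ∈ ⋃₀ R, ∀ y, ({x, y} : Set α) ∈ Q → y ∈ ⋃₀ R := by
    rintro x ⟨B, hB, hx⟩ y hxy
    refine ⟨B, hB, ?_⟩
    have hBh : ∀ z, ({vh, z} : Set α) ∈ Q → z = vm ∨ z = vp := H.hh
    rcases hR hB with ⟨hBQ, hBn⟩ | hBB
    · obtain ⟨p, q, hpq, rfl⟩ := Set.ncard_eq_two.1 (hQ.1 B hBQ).2
      have hq : p ≠ vh := by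
        rintro rfl
        apply hBn
        rcases hBh q hBQ with rfl | rfl <;> simp
      have hq' : q ≠ vh := by
        rintro rfl
        apply hBn
        rcases hBh p (H.symm _ _ hBQ) with rfl | rfl <;> simp [Set.pair_comm]
      rcases hx with rfl | rfl
      · right; exact H.uniq x y q hq hxy hBQ
      · left; exact H.uniq x y p hq' hxy (H.symm _ _ hBQ)
    · rw [Set.mem_singleton_iff] at hBB
      subst hBB
      rcases hx with rfl | rfl | rfl
      · right; exact hBh y hxy
      · left; exact H.uniq x y vh (H.irr _ _ H.hc).symm hxy (H.symm _ _ H.hc)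
      · left; exact H.uniq x y vh (H.irr _ _ H.hd).symm hxy (H.symm _ _ H.hd)
  refine ⟨Set.inter_subset_right, fun v hv hvM => ?_⟩
  have hv' : v ∉ ⋃₀ R := fun h => hvM ⟨h, hv⟩
  have hnA : ∀ x ∈ ⋃₀ R, ({x, v} : Set α) ∉ Q := fun x hx h => hv' (hcl x hx v h)
  rcases hI.2 v ⟨hW hv, hv'⟩ with h | h
  · left
    intro x hx
    exact Or.inl ⟨h x hx.1, by rw [Set.pair_comm]; exact hnA x hx.1⟩
  · right
    intro x hx
    exact Or.inl ⟨h x hx.1, hnA x hx.1⟩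

/-- The intersection of a nontrivial union of blocks with `V ∖ {c}` is nontrivial. -/
theorem back {α : Type*} [LinearOrder α] {V : Set α} {Q : Set (Set α)}
    (hQ : IsPartialQuasiPairingOn V Q)
    {vh vm vp : α} (H : QP (fun x y => ({x, y} : Set α) ∈ Q) V vh vm vp)
    {R : Set (Set α)} (hR : R ⊆ QPart Q vh vm vp) (hI : IsNontrivialIntervalOf V (⋃₀ R))
    {W : Set α} (hW : W = V ∨ W = V \ {vm} ∨ W = V \ {vp}) (hind : IndecomposableOn Q W) :
    False := by
  have hWV : W ⊆ V := by
    rcases hW with rfl | rfl | rfl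
    exacts [subset_rfl, Set.diff_subset, Set.diff_subset]
  have ht := hind _ (module_of hQ H hR hI.1 hWV)
  obtain ⟨⟨x, ⟨B, hB, hxB⟩, -⟩, v, hvV, hvR⟩ := nontriv hI.2 hI.1.1
  have hhm := H.irr _ _ H.hc
  have hhp := H.irr _ _ H.hd
  have hmp := H.cd
  have hBV : B ⊆ V := fun z hz => hI.1.1 ⟨B, hB, hz⟩
  -- two points of `B` in `W`
  have two : ∃ p ∈ B, ∃ q ∈ B, p ≠ q ∧ p ∈ W ∧ q ∈ W := by
    rcases hR hB with ⟨hBQ, hBn⟩ | hBB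
    · obtain ⟨p, q, hpq, rfl⟩ := Set.ncard_eq_two.1 (hQ.1 B hBQ).2
      have key : ∀ c, c = vm ∨ c = vp → p ≠ c ∧ q ≠ c := by
        intro c hc
        have hAc : ∀ z, ({c, z} : Set α) ∈ Q → z = vh := by
          intro z hz
          rcases hc with rfl | rfl
          · exact H.uniq c z vh hhm.symm hz (H.symm _ _ H.hc)
          · exact H.uniq c z vh hhp.symm hz (H.symm _ _ H.hd)
        constructor
        · rintro rfl
          apply hBn
          rw [hAc q hBQ]
          rcases hc with rfl | rfl <;> simp [Set.pair_comm]
        · rintro rfl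
          apply hBn
          rw [hAc p (H.symm _ _ hBQ)]
          rcases hc with rfl | rfl <;> simp
      refine ⟨p, by simp, q, by simp, hpq, ?_⟩
      have hp : p ∈ V := hBV (by simp)
      have hq : q ∈ V := hBV (by simp)
      have k1 := key vm (Or.inl rfl)
      have k2 := key vp (Or.inr rfl)
      rcases hW with rfl | rfl | rfl
      exacts [⟨hp, hq⟩, ⟨⟨hp, k1.1⟩, hq, k1.2⟩, ⟨⟨hp, k2.1⟩, hq, k2.2⟩]
    · rw [Set.mem_singleton_iff] at hBB
      subst hBB
      have e1 : vh ∈ V := hBV (by simp)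
      have e2 : vm ∈ V := hBV (by simp)
      have e3 : vp ∈ V := hBV (by simp)
      rcases hW with rfl | rfl | rfl
      · exact ⟨vh, by simp, vm, by simp, hhm, e1, e2⟩
      · exact ⟨vh, by simp, vp, by simp, hhp, ⟨e1, hhm⟩, e3, hmp.symm⟩
      · exact ⟨vh, by simp, vm, by simp, hhm, ⟨e1, hhp⟩, e2, hmp⟩
  obtain ⟨p, hp, q, hq, hpq, hpW, hqW⟩ := two
  have heq := triv_two ht ⟨⟨B, hB, hp⟩, hpW⟩ ⟨⟨B, hB, hq⟩, hqW⟩ hpq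
  have hWR : W ⊆ ⋃₀ R := fun z hz => (heq.symm ▸ hz : z ∈ ⋃₀ R ∩ W).1
  have hvW : v ∉ W := fun h => hvR (hWR h)
  -- then `vh ∈ ⋃₀ R`, hence the whole block
  have hhV : vh ∈ V := H.mem _ _ H.hc
  have hhW : vh ∈ W := by
    rcases hW with rfl | rfl | rfl
    exacts [hhV, ⟨hhV, hhm⟩, ⟨hhV, hhp⟩]
  have hvmp : v = vm ∨ v = vp := by
    rcases hW with rfl | rfl | rfl
    · exact absurd hvV hvW
    · left; by_contra hc; exact hvW ⟨hvV, hc⟩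
    · right; by_contra hc; exact hvW ⟨hvV, hc⟩
  obtain ⟨C, hC, hhC⟩ := hWR hhW
  apply hvR
  refine ⟨C, hC, ?_⟩
  have hBh : ∀ z, ({vh, z} : Set α) ∈ Q → z = vm ∨ z = vp := H.hh
  rcases hR hC with ⟨hCQ, hCn⟩ | hCC
  · exfalso
    obtain ⟨p, q, hpq, rfl⟩ := Set.ncard_eq_two.1 (hQ.1 C hCQ).2
    apply hCn
    rcases hhC with rfl | rfl
    · rcases hBh q hCQ with rfl | rfl <;> simp
    · rcases hBh p (H.symm _ _ hCQ) with rfl | rfl <;> simp [Set.pair_comm]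
  · rw [Set.mem_singleton_iff] at hCC
    subst hCC
    right; exact hvmp

theorem indec_del {α : Type*} [LinearOrder α] {V : Set α} (hVfin : V.Finite)
    (hVcard : 7 ≤ V.ncard) {Q : Set (Set α)}
    {h c d : α} (H : QP (fun x y => ({x, y} : Set α) ∈ Q) V h c d)
    (hirr : Irr (fun x y => ({x, y} : Set α) ∈ Q) V)
    (hg : Good (fun x y => ({x, y} : Set α) ∈ Q) V h c) : IndecomposableOn Q (V \ {c}) := by
  intro M hM
  refine pairing_indec H.symm ?_ ?_ (good_irr H hirr hg) (md_of_module hM)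
  · intro x hx y hy z hz hxy hxz
    by_cases hxh : x = h
    · subst hxh
      rcases H.hh y hxy with e | e
      · exact absurd e hy.2
      · rcases H.hh z hxz with e' | e'
        · exact absurd e' hz.2
        · exact e.trans e'.symm
    · exact H.uniq x y z hxh hxy hxz
  · have := Set.ncard_diff_singleton_add_one (H.mem _ _ (H.symm _ _ H.hc)) hVfin
    omega

/-- Corollary 2. Let `V` be a finite totally ordered set of odd size
`|V| ≥ 7`, `Q` a quasi-pairing of `V` (so `⋃₀ Q = V`) with distinguished data
`(vh, vm, vp)`, and `T := Inv(underline(V), Q)`. Then `Q` is irreducible iff at least one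
of `T`, `T − v_Q^-`, `T − v_Q^+` is indecomposable. -/
theorem stmt_3 {α : Type*} [LinearOrder α] (V : Set α) (hVfin : V.Finite)
    (hVcard : 7 ≤ V.ncard) (hVodd : Odd V.ncard)
    (Q : Set (Set α)) (hQ : IsPartialQuasiPairingOn V Q) (hcover : ⋃₀ Q = V)
    (vh vm vp : α) (hdata : QPData Q vh vm vp) :
    IrreducibleOn V (QPart Q vh vm vp) ↔
      (IndecomposableOn Q V ∨ IndecomposableOn Q (V \ {vm}) ∨
        IndecomposableOn Q (V \ {vp})) := by
  have H := qp_of hQ hdata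
  constructor
  · intro hI
    have hirr := irr_of hQ hcover H hI
    by_cases hind : IndecomposableOn Q V
    · exact Or.inl hind
    right
    unfold IndecomposableOn at hind
    push Not at hind
    obtain ⟨M, hM, hnt⟩ := hind
    rcases main_case H hVcard hirr (md_of_module hM) hnt with hg | hg
    · exact Or.inl (indec_del hVfin hVcard H hirr hg)
    · exact Or.inr (indec_del hVfin hVcard H.swap hirr hg)
  · intro hind R hR hI
    rcases hind with h | h | h
    · exact back hQ H hR hI (Or.inl rfl) h
    · exact back hQ H hR hI (Or.inr (Or.inl rfl)) h
    · exact back hQ H hR hI (Or.inr (Or.inr rfl)) h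
end
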